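/- Let G be a topological group and 0 < p < q < ∞. Let ψ : G → ℝ≥0 be a continuous function such that ψ(g) = ‖α_g(0)‖_{L_p}^p for some continuous affine isometric action α of G on an L_p space. Then there exist a standard σ-finite measure space (Y,ν), a continuous measure-preserving action σ of G on (Y,ν), and a function h ∈ L_∞(Y,ν) such that for every g ∈ G the function b(g) = h∘σ_g^{-1} − h belongs to L_q(Y,ν) and ψ(g) = ‖b(g)‖_{L_q}^q. In particular, ψ(g) = ‖β_g(0)‖_{L_q}^q for a continuous affine isometric action β of G on an L_q space whose linear part comes from a measure-preserving action of G. -/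

import Mathlib

open MeasureTheory ENNReal symmDiff

/-- The quantity `‖f‖_p^p = ∫ |f|^p dμ`, valued in `ℝ≥0∞`. -/
noncomputable def pPow {X : Type*} [MeasurableSpace X] (μ : Measure X) (p : ℝ)
    {E : Type*} [NormedAddCommGroup E] (f : X →ₘ[μ] E) : ℝ≥0∞ :=
  ∫⁻ x, (‖f x‖₊ : ℝ≥0∞) ^ p ∂μ

/-- A continuous affine isometric action of a topological group `G` on the (real)
space `L_p(X,μ)`. -/
structure AffineIsometricAction (G : Type*) [Group G] [TopologicalSpace G]
    {X : Type*} [MeasurableSpace X] (μ : Measure X) (p : ℝ) where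
  act : G → Lp ℝ (ENNReal.ofReal p) μ → Lp ℝ (ENNReal.ofReal p) μ
  act_one : ∀ f, act 1 f = f
  act_mul : ∀ g h f, act (g * h) f = act g (act h f)
  isometry : ∀ g f f',
    pPow μ p ((act g f : X →ₘ[μ] ℝ) - (act g f' : X →ₘ[μ] ℝ))
      = pPow μ p ((f : X →ₘ[μ] ℝ) - (f' : X →ₘ[μ] ℝ))
  affine : ∀ (g : G) (t : ℝ) (f f' : Lp ℝ (ENNReal.ofReal p) μ),
    act g (t • f + (1 - t) • f') = t • act g f + (1 - t) • act g f'
  continuous : ∀ (f : Lp ℝ (ENNReal.ofReal p) μ) (g₀ : G),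
    Filter.Tendsto (fun g => pPow μ p ((act g f : X →ₘ[μ] ℝ) - (act g₀ f : X →ₘ[μ] ℝ)))
      (nhds g₀) (nhds 0)

/-- A continuous measure-preserving action of a topological group `G` on `(X,μ)`. -/
structure PMPAction (G : Type*) [Group G] [TopologicalSpace G]
    {X : Type*} [MeasurableSpace X] (μ : Measure X) where
  σ : G → X → X
  measurable : ∀ g, Measurable (σ g)
  measurePreserving : ∀ g, MeasurePreserving (σ g) μ μ
  σ_one : σ 1 =ᵐ[μ] id
  σ_mul : ∀ g h, σ (g * h) =ᵐ[μ] (σ g) ∘ (σ h)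
  continuous : ∀ (A : Set X), MeasurableSet A → μ A ≠ ⊤ → ∀ g₀ : G,
    Filter.Tendsto (fun g => μ ((σ g ⁻¹' A) ∆ (σ g₀ ⁻¹' A))) (nhds g₀) (nhds 0)

section
open Filter Topology

theorem aux_tendsto_of_subseq {G : Type*} {l : Filter G} {D E : G → ℝ≥0∞}
    (hD : Tendsto D l (𝓝 0))
    (H : ∀ u : ℕ → G, Tendsto (fun n => D (u n)) atTop (𝓝 0) →
      ∃ φ : ℕ → ℕ, Tendsto (fun k => E (u (φ k))) atTop (𝓝 0)) :
    Tendsto E l (𝓝 0) := by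
  have h1 : l ≤ comap D (𝓝 0) := tendsto_iff_comap.mp hD
  refine Tendsto.mono_left ?_ h1
  refine tendsto_of_subseq_tendsto ?_
  intro u hu
  exact H u (tendsto_comap_iff.mp hu)

theorem aux_ae_subseq {X : Type*} [MeasurableSpace X] {μ : Measure X} (u : ℕ → X → ℝ≥0∞)
    (hu : ∀ n, AEMeasurable (u n) μ)
    (h : Tendsto (fun n => ∫⁻ x, u n x ∂μ) atTop (𝓝 0)) :
    ∃ φ : ℕ → ℕ, ∀ᵐ x ∂μ, Tendsto (fun k => u (φ k) x) atTop (𝓝 0) := by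
  have : ∀ k : ℕ, ∃ n, ∫⁻ x, u n x ∂μ ≤ (2 : ℝ≥0∞)⁻¹ ^ k := by
    intro k
    have hpos : (0 : ℝ≥0∞) < (2 : ℝ≥0∞)⁻¹ ^ k := by
      apply ENNReal.pow_pos
      simp
    exact ((tendsto_order.mp h).2 _ hpos).exists.imp (fun n hn => hn.le)
  choose φ hφ using this
  refine ⟨φ, ?_⟩
  have hs : ∫⁻ x, ∑' k, u (φ k) x ∂μ ≠ ⊤ := by
    rw [lintegral_tsum (fun k => hu (φ k))]
    refine ne_top_of_le_ne_top ?_ (ENNReal.tsum_le_tsum hφ)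
    rw [ENNReal.tsum_geometric]
    simp
  have hm : AEMeasurable (fun x => ∑' k, u (φ k) x) μ := AEMeasurable.tsum (fun k => hu (φ k))
  filter_upwards [ae_lt_top' hm hs] with x hx
  exact ENNReal.tendsto_atTop_zero_of_tsum_ne_top hx.ne

theorem aux_symmDiff_tendsto {Y : Type*} [MeasurableSpace Y] {ν : Measure Y}
    (τ : ℕ → Y → Y) (τ0 : Y → Y) (hτ : ∀ n, MeasurePreserving (τ n) ν ν)
    (hτ0 : MeasurePreserving τ0 ν ν) {A : Set Y} (hA : MeasurableSet A) (hfin : ν A ≠ ⊤)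
    (h : ∀ᵐ y ∂ν, τ0 y ∈ A → ∀ᶠ n in atTop, τ n y ∈ A) :
    Tendsto (fun n => ν ((τ n ⁻¹' A) ∆ (τ0 ⁻¹' A))) atTop (𝓝 0) := by
  have m0 : MeasurableSet (τ0 ⁻¹' A) := hτ0.measurable hA
  have mn : ∀ n, MeasurableSet (τ n ⁻¹' A) := fun n => (hτ n).measurable hA
  have e0 : ν (τ0 ⁻¹' A) = ν A := hτ0.measure_preimage hA.nullMeasurableSet
  have en : ∀ n, ν (τ n ⁻¹' A) = ν A := fun n => (hτ n).measure_preimage hA.nullMeasurableSet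
  have key : Tendsto (fun n => ν (τ0 ⁻¹' A \ τ n ⁻¹' A)) atTop (𝓝 0) := by
    have := tendsto_lintegral_of_dominated_convergence (μ := ν)
      (F := fun n => (τ0 ⁻¹' A \ τ n ⁻¹' A).indicator (fun _ => (1 : ℝ≥0∞)))
      (f := fun _ => 0) ((τ0 ⁻¹' A).indicator (fun _ => (1 : ℝ≥0∞)))
      (fun n => measurable_const.indicator (m0.diff (mn n)))
      (fun n => Eventually.of_forall (fun y => by
        apply Set.indicator_le_indicator_of_subset Set.sdiff_subset (by simp)))
      (by rw [lintegral_indicator_const m0, e0]; simpa using hfin)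
      (by
        filter_upwards [h] with y hy
        by_cases h0 : τ0 y ∈ A
        · refine tendsto_const_nhds.congr' ?_
          filter_upwards [hy h0] with n hn
          simp [hn]
        · refine tendsto_const_nhds.congr' (Eventually.of_forall fun n => ?_)
          simp [h0])
    simpa [lintegral_indicator_const (m0.diff (mn _))] using this
  have heq : ∀ n, ν (τ n ⁻¹' A \ τ0 ⁻¹' A) = ν (τ0 ⁻¹' A \ τ n ⁻¹' A) := by
    intro n
    have h1 := measure_sdiff_add_inter (μ := ν) (τ n ⁻¹' A) m0
    have h2 := measure_sdiff_add_inter (μ := ν) (τ0 ⁻¹' A) (mn n)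
    rw [en n] at h1
    rw [e0, ← h1, Set.inter_comm] at h2
    refine (WithTop.add_right_cancel ?_ h2).symm
    refine ne_top_of_le_ne_top hfin ?_
    rw [← en n]
    exact measure_mono Set.inter_subset_left
  have : (fun n => ν ((τ n ⁻¹' A) ∆ (τ0 ⁻¹' A)))
      = fun n => ν (τ0 ⁻¹' A \ τ n ⁻¹' A) + ν (τ0 ⁻¹' A \ τ n ⁻¹' A) := by
    funext n
    rw [measure_symmDiff_eq (mn n).nullMeasurableSet m0.nullMeasurableSet, heq n]
  rw [this]
  simpa using key.add key

theorem aux_cont_approx {G : Type*} {l : Filter G} {Y : Type*} [MeasurableSpace Y]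
    {ν : Measure Y} (σ : G → Y → Y) (hσ : ∀ g, MeasurePreserving (σ g) ν ν) (g₀ : G)
    {A : Set Y} (hA : MeasurableSet A)
    (h : ∀ ε : ℝ≥0∞, 0 < ε → ∃ A', MeasurableSet A' ∧ ν (A ∆ A') ≤ ε ∧
      Tendsto (fun g => ν ((σ g ⁻¹' A') ∆ (σ g₀ ⁻¹' A'))) l (𝓝 0)) :
    Tendsto (fun g => ν ((σ g ⁻¹' A) ∆ (σ g₀ ⁻¹' A))) l (𝓝 0) := by
  rw [ENNReal.tendsto_nhds_zero]
  intro ε hε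
  have hε3 : 0 < ε / 3 := by simp [hε.ne']
  obtain ⟨A', hA', hAA, ht⟩ := h (ε / 3) hε3
  rw [ENNReal.tendsto_nhds_zero] at ht
  filter_upwards [ht _ hε3] with g hg
  have e : ∀ g, ν ((σ g ⁻¹' A) ∆ (σ g ⁻¹' A')) ≤ ε / 3 := by
    intro g
    rw [← Set.preimage_symmDiff, (hσ g).measure_preimage (hA.symmDiff hA').nullMeasurableSet]
    exact hAA
  calc ν ((σ g ⁻¹' A) ∆ (σ g₀ ⁻¹' A))
      ≤ ν ((σ g ⁻¹' A) ∆ (σ g ⁻¹' A')) + ν ((σ g ⁻¹' A') ∆ (σ g₀ ⁻¹' A)) :=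
        measure_symmDiff_le _ _ _
    _ ≤ ν ((σ g ⁻¹' A) ∆ (σ g ⁻¹' A')) + (ν ((σ g ⁻¹' A') ∆ (σ g₀ ⁻¹' A'))
          + ν ((σ g₀ ⁻¹' A') ∆ (σ g₀ ⁻¹' A))) := by
        gcongr; exact measure_symmDiff_le _ _ _
    _ ≤ ε / 3 + (ε / 3 + ε / 3) := by
        gcongr
        · exact e g
        · rw [symmDiff_comm]; exact e g₀
    _ = ε := by rw [← add_assoc, ENNReal.add_thirds]

theorem aux_cont_of_pi {G : Type*} {l : Filter G} {Y : Type*} [mY : MeasurableSpace Y]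
    {ν : Measure Y} (σ : G → Y → Y) (hσ : ∀ g, MeasurePreserving (σ g) ν ν) (g₀ : G)
    (P : Set (Set Y)) (hgen : mY = MeasurableSpace.generateFrom P) (hpi : IsPiSystem P)
    (K : ℕ → Set Y) (hKP : ∀ n, K n ∈ P) (hKfin : ∀ n, ν (K n) ≠ ⊤) (hKm : Monotone K)
    (hKU : ⋃ n, K n = Set.univ)
    (hc : ∀ A ∈ P, ν A ≠ ⊤ → Tendsto (fun g => ν ((σ g ⁻¹' A) ∆ (σ g₀ ⁻¹' A))) l (𝓝 0)) :
    ∀ A, MeasurableSet A → ν A ≠ ⊤ →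
      Tendsto (fun g => ν ((σ g ⁻¹' A) ∆ (σ g₀ ⁻¹' A))) l (𝓝 0) := by
  have hKmeas : ∀ n, MeasurableSet (K n) := fun n => by
    rw [hgen]; exact MeasurableSpace.measurableSet_generateFrom (hKP n)
  have hempty : Tendsto (fun g => ν ((σ g ⁻¹' (∅ : Set Y)) ∆ (σ g₀ ⁻¹' ∅))) l (𝓝 0) := by simp [tendsto_const_nhds]
  have hdiff : ∀ A B : Set Y, Tendsto (fun g => ν ((σ g ⁻¹' A) ∆ (σ g₀ ⁻¹' A))) l (𝓝 0) →
      Tendsto (fun g => ν ((σ g ⁻¹' B) ∆ (σ g₀ ⁻¹' B))) l (𝓝 0) →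
      Tendsto (fun g => ν ((σ g ⁻¹' (A \ B)) ∆ (σ g₀ ⁻¹' (A \ B)))) l (𝓝 0) := by
    intro A B h1 h2
    have h3 := h1.add h2
    rw [add_zero] at h3
    refine tendsto_of_tendsto_of_tendsto_of_le_of_le tendsto_const_nhds h3 (fun _ => zero_le)
      (fun g => (measure_mono ?_).trans (measure_union_le _ _))
    intro y
    simp only [Set.mem_symmDiff, Set.mem_preimage, Set.mem_sdiff, Set.mem_union]
    tauto
  have hunion : ∀ A B : Set Y, Tendsto (fun g => ν ((σ g ⁻¹' A) ∆ (σ g₀ ⁻¹' A))) l (𝓝 0) →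
      Tendsto (fun g => ν ((σ g ⁻¹' B) ∆ (σ g₀ ⁻¹' B))) l (𝓝 0) →
      Tendsto (fun g => ν ((σ g ⁻¹' (A ∪ B)) ∆ (σ g₀ ⁻¹' (A ∪ B)))) l (𝓝 0) := by
    intro A B h1 h2
    have h3 := h1.add h2
    rw [add_zero] at h3
    refine tendsto_of_tendsto_of_tendsto_of_le_of_le tendsto_const_nhds h3 (fun _ => zero_le)
      (fun g => (measure_mono ?_).trans (measure_union_le _ _))
    intro y
    simp only [Set.mem_symmDiff, Set.mem_preimage, Set.mem_union]
    tauto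
  -- approximation from below
  have happ : ∀ (B : ℕ → Set Y), (∀ n, MeasurableSet (B n)) → Monotone B → ν (⋃ n, B n) ≠ ⊤ →
      (∀ n, Tendsto (fun g => ν ((σ g ⁻¹' (B n)) ∆ (σ g₀ ⁻¹' (B n)))) l (𝓝 0)) →
      Tendsto (fun g => ν ((σ g ⁻¹' (⋃ n, B n)) ∆ (σ g₀ ⁻¹' (⋃ n, B n)))) l (𝓝 0) := by
    intro B hB hBm hfin hBc
    refine aux_cont_approx σ hσ g₀ (MeasurableSet.iUnion hB) ?_
    intro ε hε
    have ht := tendsto_measure_iUnion_atTop (μ := ν) hBm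
    have ht2 : Tendsto (fun n => ν (⋃ n, B n) - ν (B n)) atTop (𝓝 0) := by
      have := ENNReal.Tendsto.sub (tendsto_const_nhds (x := ν (⋃ n, B n))) ht (Or.inl hfin)
      simpa using this
    rw [ENNReal.tendsto_nhds_zero] at ht2
    obtain ⟨n, hn⟩ := (ht2 ε hε).exists
    refine ⟨B n, hB n, ?_, hBc n⟩
    have hsub : B n ⊆ ⋃ n, B n := Set.subset_iUnion B n
    rw [symmDiff_of_ge hsub]
    refine le_trans (le_of_eq ?_) hn
    exact measure_sdiff hsub (hB n).nullMeasurableSet (ne_top_of_le_ne_top hfin (measure_mono hsub))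
  have step1 : ∀ n A, MeasurableSet A →
      Tendsto (fun g => ν ((σ g ⁻¹' (A ∩ K n)) ∆ (σ g₀ ⁻¹' (A ∩ K n)))) l (𝓝 0) := by
    intro n A hA
    induction A, hA using MeasurableSpace.induction_on_inter hgen hpi with
    | empty => simp [tendsto_const_nhds]
    | basic A hA =>
      by_cases hne : (A ∩ K n).Nonempty
      · exact hc _ (hpi _ hA _ (hKP n) hne)
          (ne_top_of_le_ne_top (hKfin n) (measure_mono Set.inter_subset_right))
      · rw [Set.not_nonempty_iff_eq_empty.mp hne]; exact hempty
    | compl A hA ih =>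
      have : Aᶜ ∩ K n = K n \ (A ∩ K n) := by ext; simp; tauto
      rw [this]
      exact hdiff _ _ (hc _ (hKP n) (hKfin n)) ih
    | iUnion f hd hm ih =>
      have : (⋃ i, f i) ∩ K n = ⋃ N, (⋃ i ∈ Finset.range N, f i) ∩ K n := by
        ext y
        simp only [Set.mem_inter_iff, Set.mem_iUnion, Finset.mem_range]
        constructor
        · rintro ⟨⟨i, hi⟩, hk⟩
          exact ⟨i + 1, ⟨i, by omega, hi⟩, hk⟩
        · rintro ⟨N, ⟨i, _, hi⟩, hk⟩
          exact ⟨⟨i, hi⟩, hk⟩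
      rw [this]
      refine happ _ ?_ ?_ ?_ ?_
      · intro N
        exact (Finset.measurableSet_biUnion _ (fun i _ => hm i)).inter (hKmeas n)
      · intro N N' hN
        refine Set.inter_subset_inter_left _ ?_
        refine Set.biUnion_subset_biUnion_left ?_
        intro i hi
        simp at hi ⊢
        omega
      · rw [← this]
        exact ne_top_of_le_ne_top (hKfin n) (measure_mono Set.inter_subset_right)
      · intro N
        induction N with
        | zero => simp [tendsto_const_nhds]
        | succ N ihN =>
          have : (⋃ i ∈ Finset.range (N + 1), f i) ∩ K n
              = (f N ∩ K n) ∪ ((⋃ i ∈ Finset.range N, f i) ∩ K n) := by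
            rw [Finset.range_add_one, Finset.set_biUnion_insert, Set.union_inter_distrib_right]
          rw [this]
          exact hunion _ _ (ih N) ihN
  intro A hA hfin
  have : A = ⋃ n, A ∩ K n := by rw [← Set.inter_iUnion, hKU, Set.inter_univ]
  rw [this]
  refine happ _ (fun n => hA.inter (hKmeas n)) ?_ ?_ (fun n => step1 n A hA)
  · intro n n' hn
    exact Set.inter_subset_inter_right _ (hKm hn)
  · rw [← this]; exact hfin

end

section
open Filter Topology

/-- the measure `e^{(p-1)r} dr` on the scale line. -/
noncomputable def lamM (p : ℝ) : Measure ℝ :=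
  (volume : Measure ℝ).withDensity (fun r => ENNReal.ofReal (Real.exp ((p - 1) * r)))

instance lamM_sigmaFinite (p : ℝ) : SigmaFinite (lamM p) := by
  unfold lamM
  exact SigmaFinite.withDensity_ofReal _

/-- the fibre measure. -/
noncomputable def fibM (p : ℝ) : Measure (ℝ × ℝ) := (volume : Measure ℝ).prod (lamM p)

instance fibM_sigmaFinite (p : ℝ) : SigmaFinite (fibM p) := by
  unfold fibM; infer_instance

theorem lamM_shift (p l : ℝ) (v : ℝ → ℝ≥0∞) (hv : Measurable v) :
    ∫⁻ r, v (r - l) ∂(lamM p) = ENNReal.ofReal (Real.exp ((p - 1) * l)) * ∫⁻ r, v r ∂(lamM p) := by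
  unfold lamM
  rw [lintegral_withDensity_eq_lintegral_mul _ (by fun_prop) (by fun_prop),
    lintegral_withDensity_eq_lintegral_mul _ (by fun_prop) hv,
    ← lintegral_const_mul _ (by fun_prop)]
  symm
  rw [← lintegral_sub_right_eq_self _ l]
  congr 1
  funext r
  simp only [Pi.mul_apply]
  rw [← mul_assoc, ← ENNReal.ofReal_mul (Real.exp_pos _).le, ← Real.exp_add]
  congr 3
  ring

theorem vol_affine (b F : ℝ) (hF : F ≠ 0) (w : ℝ → ℝ≥0∞) (hw : Measurable w) :
    ∫⁻ a, w ((a - b) / F) = ENNReal.ofReal |F| * ∫⁻ a, w a := by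
  rw [lintegral_sub_right_eq_self (fun a => w (a / F)) b]
  have h := Real.map_volume_mul_left (inv_ne_zero hF)
  have h2 : ∫⁻ a, w (a / F) = ∫⁻ a, w a ∂(Measure.map (F⁻¹ * ·) volume) := by
    rw [lintegral_map hw (by fun_prop)]
    congr 1; funext a; congr 1; field_simp
  rw [h2, h, lintegral_smul_measure]
  simp

theorem fibM_scale (p b F : ℝ) (hF : F ≠ 0) (u : ℝ × ℝ → ℝ≥0∞) (hu : Measurable u) :
    ∫⁻ z, u ((z.1 - b) / F, z.2 - Real.log |F|) ∂(fibM p)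
      = ENNReal.ofReal (|F| ^ p) * ∫⁻ z, u z ∂(fibM p) := by
  unfold fibM
  rw [lintegral_prod _ (by fun_prop), lintegral_prod _ (by fun_prop)]
  have : ∀ a, ∫⁻ r, u ((a - b) / F, r - Real.log |F|) ∂(lamM p) =
      ENNReal.ofReal (Real.exp ((p - 1) * Real.log |F|)) * ∫⁻ r, u ((a - b) / F, r) ∂(lamM p) :=
    fun a => lamM_shift p _ (fun r => u ((a - b) / F, r)) (by fun_prop)
  simp only [this]
  have hm : Measurable (fun a => ∫⁻ r, u (a, r) ∂(lamM p)) := hu.lintegral_prod_right'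
  rw [lintegral_const_mul _ (by fun_prop),
    vol_affine b F hF (fun a => ∫⁻ r, u (a, r) ∂(lamM p)) hm, ← mul_assoc,
    ← ENNReal.ofReal_mul (Real.exp_pos _).le]
  congr 2
  have : 0 < |F| := abs_pos.mpr hF
  rw [mul_comm (p-1), Real.exp_mul, Real.exp_log this]
  nth_rewrite 2 [← Real.rpow_one |F|]
  rw [← Real.rpow_add this]
  congr 1; ring

/-- tent function -/
noncomputable def tent (t : ℝ) : ℝ := max 0 (1 - |t|)

theorem tent_cont : Continuous tent := by unfold tent; fun_prop
theorem tent_nonneg (t : ℝ) : 0 ≤ tent t := le_max_left _ _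
theorem tent_le_one (t : ℝ) : tent t ≤ 1 := by
  unfold tent; have := abs_nonneg t; simp
theorem tent_eq_zero {t : ℝ} (h : 1 ≤ |t|) : tent t = 0 := by
  unfold tent; apply max_eq_left; linarith
theorem tent_lip (s t : ℝ) : |tent s - tent t| ≤ |s - t| := by
  unfold tent
  have h1 := abs_max_sub_max_le_abs (1 - |s|) (1 - |t|) 0
  rw [max_comm 0, max_comm 0]
  refine h1.trans ?_
  have := abs_abs_sub_abs_le t s
  rw [show 1 - |s| - (1 - |t|) = |t| - |s| by ring, abs_sub_comm s t]
  exact this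
theorem tent_abs {s t : ℝ} (h : |s| = |t|) : tent s = tent t := by unfold tent; rw [h]

/-- the difference kernel -/
noncomputable def kerD (t : ℝ) (z : ℝ × ℝ) : ℝ :=
  tent ((z.1 - t) * Real.exp (-z.2)) - tent (z.1 * Real.exp (-z.2))

theorem kerD_meas (t : ℝ) : Measurable (kerD t) := by
  have := tent_cont
  unfold kerD
  exact Continuous.measurable (by fun_prop)

noncomputable def cst (p q : ℝ) : ℝ≥0∞ := ∫⁻ z, ‖kerD 1 z‖ₑ ^ q ∂(fibM p)

theorem kerD_integral {p q : ℝ} (hp : 0 < p) (hq : 0 < q) (t : ℝ) :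
    ∫⁻ z, ‖kerD t z‖ₑ ^ q ∂(fibM p) = ENNReal.ofReal (|t| ^ p) * cst p q := by
  by_cases ht : t = 0
  · subst ht
    simp [kerD, hp.ne', hq]
  · have hm : Measurable (fun z => ‖kerD 1 z‖ₑ ^ q) := by have := kerD_meas 1; fun_prop
    have := fibM_scale p 0 t ht (fun z => ‖kerD 1 z‖ₑ ^ q) hm
    unfold cst
    rw [← this]
    congr 1
    funext z
    congr 2
    unfold kerD
    have hpos : 0 < |t| := abs_pos.mpr ht
    have he : Real.exp (-(z.2 - Real.log |t|)) = |t| * Real.exp (-z.2) := by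
      rw [show -(z.2 - Real.log |t|) = Real.log |t| + -z.2 by ring, Real.exp_add, Real.exp_log hpos]
    simp only [he, sub_zero]
    congr 1
    · apply tent_abs
      simp only [abs_mul, abs_abs]
      rw [← mul_assoc]
      congr 1
      rw [show z.1 / t - 1 = (z.1 - t) / t by field_simp, abs_div]
      field_simp
    · apply tent_abs
      simp only [abs_mul, abs_abs, abs_div]
      rw [← mul_assoc]
      congr 1; field_simp

theorem kerD_abs_le_one (t : ℝ) (z : ℝ × ℝ) : |kerD t z| ≤ 1 := by
  unfold kerD
  rw [abs_le]
  constructor <;> linarith [tent_nonneg ((z.1 - t) * Real.exp (-z.2)), tent_nonneg (z.1 * Real.exp (-z.2)),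
    tent_le_one ((z.1 - t) * Real.exp (-z.2)), tent_le_one (z.1 * Real.exp (-z.2))]

theorem kerD_abs_le (z : ℝ × ℝ) : |kerD 1 z| ≤ Real.exp (-z.2) := by
  unfold kerD
  refine (tent_lip _ _).trans ?_
  rw [← sub_mul, abs_mul, abs_of_pos (Real.exp_pos _)]
  simp

theorem tent_exp_zero {a r : ℝ} (h : Real.exp r ≤ |a|) : tent (a * Real.exp (-r)) = 0 := by
  apply tent_eq_zero
  rw [abs_mul, abs_of_pos (Real.exp_pos _), Real.exp_neg]
  have := Real.exp_pos r
  rw [← div_eq_mul_inv, le_div_iff₀ this]; linarith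

theorem inner_le_neg {q : ℝ} (hq : 0 < q) (r : ℝ) :
    ∫⁻ a, ‖kerD 1 (a, r)‖ₑ ^ q ≤ ENNReal.ofReal (4 * Real.exp r) := by
  have hpos := Real.exp_pos r
  calc ∫⁻ a, ‖kerD 1 (a, r)‖ₑ ^ q
      ≤ ∫⁻ a, (Set.Icc (-Real.exp r) (Real.exp r) ∪ Set.Icc (1 - Real.exp r) (1 + Real.exp r)).indicator
          (fun _ => (1 : ℝ≥0∞)) a := by
        apply lintegral_mono
        intro a
        by_cases ha : a ∈ Set.Icc (-Real.exp r) (Real.exp r) ∪ Set.Icc (1 - Real.exp r) (1 + Real.exp r)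
        · simp only [ha, Set.indicator_of_mem]
          refine ENNReal.rpow_le_one ?_ hq.le
          rw [Real.enorm_eq_ofReal_abs]
          exact ENNReal.ofReal_le_one.mpr (kerD_abs_le_one _ _)
        · have h1 : Real.exp r ≤ |a| := by
            by_contra hc
            push Not at hc
            rw [abs_lt] at hc
            exact ha (Or.inl ⟨hc.1.le, hc.2.le⟩)
          have h2 : Real.exp r ≤ |a - 1| := by
            by_contra hc
            push Not at hc
            rw [abs_lt] at hc
            exact ha (Or.inr ⟨by linarith, by linarith⟩)
          simp [kerD, tent_exp_zero h1, tent_exp_zero h2, hq]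
    _ = volume (Set.Icc (-Real.exp r) (Real.exp r) ∪ Set.Icc (1 - Real.exp r) (1 + Real.exp r)) := by
        rw [lintegral_indicator_const (by measurability), one_mul]
    _ ≤ volume (Set.Icc (-Real.exp r) (Real.exp r)) + volume (Set.Icc (1 - Real.exp r) (1 + Real.exp r)) :=
        measure_union_le _ _
    _ = ENNReal.ofReal (4 * Real.exp r) := by
        rw [Real.volume_Icc, Real.volume_Icc, ← ENNReal.ofReal_add (by linarith) (by linarith)]
        congr 1; ring

theorem inner_le_pos {q : ℝ} (hq : 0 < q) {r : ℝ} (hr : 0 ≤ r) :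
    ∫⁻ a, ‖kerD 1 (a, r)‖ₑ ^ q ≤ ENNReal.ofReal (3 * Real.exp ((1 - q) * r)) := by
  have hpos := Real.exp_pos r
  have h1r : 1 ≤ Real.exp r := Real.one_le_exp hr
  calc ∫⁻ a, ‖kerD 1 (a, r)‖ₑ ^ q
      ≤ ∫⁻ a, (Set.Icc (-Real.exp r) (1 + Real.exp r)).indicator
          (fun _ => ENNReal.ofReal (Real.exp (-r * q))) a := by
        apply lintegral_mono
        intro a
        by_cases ha : a ∈ Set.Icc (-Real.exp r) (1 + Real.exp r)
        · simp only [ha, Set.indicator_of_mem]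
          rw [Real.enorm_eq_ofReal_abs, Real.exp_mul, ← ENNReal.ofReal_rpow_of_pos (Real.exp_pos _)]
          gcongr
          exact kerD_abs_le (a, r)
        · have h1 : Real.exp r ≤ |a| := by
            by_contra hc
            push Not at hc
            rw [abs_lt] at hc
            exact ha ⟨hc.1.le, by linarith⟩
          have h2 : Real.exp r ≤ |a - 1| := by
            by_contra hc
            push Not at hc
            rw [abs_lt] at hc
            exact ha ⟨by linarith, by linarith⟩
          simp [kerD, tent_exp_zero h1, tent_exp_zero h2, hq]
    _ = ENNReal.ofReal (Real.exp (-r * q)) * volume (Set.Icc (-Real.exp r) (1 + Real.exp r)) := by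
        rw [lintegral_indicator_const (by measurability)]
    _ ≤ ENNReal.ofReal (3 * Real.exp ((1 - q) * r)) := by
        rw [Real.volume_Icc, ← ENNReal.ofReal_mul (Real.exp_pos _).le]
        apply ENNReal.ofReal_le_ofReal
        rw [show (1 - q) * r = -r * q + r by ring, Real.exp_add]
        nlinarith [Real.exp_pos (-r * q)]

theorem cst_ne_top {p q : ℝ} (hp : 0 < p) (hpq : p < q) : cst p q ≠ ⊤ := by
  have hq : 0 < q := hp.trans hpq
  have hm : Measurable (fun z => ‖kerD 1 z‖ₑ ^ q) := by have := kerD_meas 1; fun_prop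
  unfold cst fibM
  rw [lintegral_prod_symm _ hm.aemeasurable]
  unfold lamM
  rw [lintegral_withDensity_eq_lintegral_mul _ (by fun_prop) hm.lintegral_prod_left']
  rw [← lintegral_add_compl _ (measurableSet_Iic (a := (0 : ℝ)))]
  refine ENNReal.add_ne_top.mpr ⟨?_, ?_⟩
  · have hi : IntegrableOn (fun r : ℝ => 4 * Real.exp (p * r)) (Set.Iic 0) :=
      (integrableOn_exp_mul_Iic hp 0).const_mul 4
    refine ne_top_of_le_ne_top hi.lintegral_lt_top.ne ?_
    refine setLIntegral_mono' measurableSet_Iic ?_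
    intro r hr
    simp only [Pi.mul_apply]
    refine (mul_le_mul_right (inner_le_neg hq r) _).trans ?_
    rw [← ENNReal.ofReal_mul (Real.exp_pos _).le]
    apply ENNReal.ofReal_le_ofReal
    rw [show p * r = (p - 1) * r + r by ring, Real.exp_add]
    linarith
  · have hi : IntegrableOn (fun r : ℝ => 3 * Real.exp ((p - q) * r)) (Set.Ioi 0) :=
      (integrableOn_exp_mul_Ioi (by linarith) 0).const_mul 3
    rw [Set.compl_Iic]
    refine ne_top_of_le_ne_top hi.lintegral_lt_top.ne ?_
    refine setLIntegral_mono' measurableSet_Ioi ?_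
    intro r hr
    simp only [Pi.mul_apply]
    refine (mul_le_mul_right (inner_le_pos hq (le_of_lt hr)) _).trans ?_
    rw [← ENNReal.ofReal_mul (Real.exp_pos _).le]
    apply ENNReal.ofReal_le_ofReal
    rw [show (p - q) * r = (p - 1) * r + (1 - q) * r by ring, Real.exp_add]
    linarith

theorem cst_ne_zero {p q : ℝ} (hp : 0 < p) (hpq : p < q) : cst p q ≠ 0 := by
  have hq : 0 < q := hp.trans hpq
  have hm : Measurable (fun z => ‖kerD 1 z‖ₑ ^ q) := by have := kerD_meas 1; fun_prop
  unfold cst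
  intro h0
  rw [lintegral_eq_zero_iff hm] at h0
  unfold fibM at h0
  have hac : (volume : Measure ℝ) ≪ lamM p := by
    unfold lamM
    refine withDensity_absolutelyContinuous' (by fun_prop) ?_
    exact Eventually.of_forall (fun r => by simp [Real.exp_pos])
  have h1 := (Measure.AbsolutelyContinuous.rfl (μ := (volume : Measure ℝ)).prod hac).ae_le h0
  have hc : Continuous (fun z => kerD 1 z) := by
    have := tent_cont
    unfold kerD; fun_prop
  have h2 : (fun z => kerD 1 z) =ᵐ[(volume : Measure ℝ).prod volume] fun _ => 0 := by
    filter_upwards [h1] with z hz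
    simp only [Pi.zero_apply, ENNReal.rpow_eq_zero_iff, enorm_eq_zero] at hz
    rcases hz with hz | hz
    · exact hz.1
    · simp at hz
  have h3 := hc.ae_eq_iff_eq _ continuous_const |>.mp h2
  have h4 := congrFun h3 (0, 0)
  simp [kerD, tent] at h4

end

section
open Filter Topology

theorem pPow_congr {X : Type*} [MeasurableSpace X] {μ : Measure X} {p : ℝ} {F : X →ₘ[μ] ℝ}
    {f : X → ℝ} (h : F =ᵐ[μ] f) : pPow μ p F = ∫⁻ x, ‖f x‖ₑ ^ p ∂μ := by
  unfold pPow
  apply lintegral_congr_ae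
  filter_upwards [h] with x hx
  rw [hx]; rfl

theorem eLpNorm_rpow_eq {X : Type*} [MeasurableSpace X] {μ : Measure X} {p : ℝ} (hp : 0 < p)
    (f : X → ℝ) : eLpNorm f (ENNReal.ofReal p) μ ^ p = ∫⁻ x, ‖f x‖ₑ ^ p ∂μ := by
  rw [eLpNorm_eq_lintegral_rpow_enorm_toReal (by simpa using hp) ENNReal.ofReal_ne_top,
    ENNReal.toReal_ofReal hp.le, ← ENNReal.rpow_mul, one_div, inv_mul_cancel₀ hp.ne',
    ENNReal.rpow_one]

theorem memLp_of_lint {X : Type*} [MeasurableSpace X] {μ : Measure X} {p : ℝ} (hp : 0 < p)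
    {f : X → ℝ} (hf : AEStronglyMeasurable f μ) (h : ∫⁻ x, ‖f x‖ₑ ^ p ∂μ ≠ ⊤) :
    MemLp f (ENNReal.ofReal p) μ := by
  refine ⟨hf, ?_⟩
  rw [← eLpNorm_rpow_eq hp] at h
  rw [lt_top_iff_ne_top]
  intro h2
  rw [h2, ENNReal.top_rpow_of_pos hp] at h
  exact h rfl

theorem lint_of_memLp {X : Type*} [MeasurableSpace X] {μ : Measure X} {p : ℝ} (hp : 0 < p)
    {f : X → ℝ} (hf : MemLp f (ENNReal.ofReal p) μ) : ∫⁻ x, ‖f x‖ₑ ^ p ∂μ ≠ ⊤ := by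
  rw [← eLpNorm_rpow_eq hp]
  exact ENNReal.rpow_ne_top_of_nonneg hp.le hf.2.ne

theorem rpow_add_le_two {q : ℝ} (hq : 0 < q) (a b : ℝ≥0∞) :
    (a + b) ^ q ≤ 2 ^ q * (a ^ q + b ^ q) := by
  have h : a + b ≤ 2 * max a b := by
    rw [two_mul]; exact add_le_add (le_max_left _ _) (le_max_right _ _)
  calc (a + b) ^ q ≤ (2 * max a b) ^ q := by gcongr
    _ = 2 ^ q * (max a b) ^ q := ENNReal.mul_rpow_of_nonneg _ _ hq.le
    _ ≤ 2 ^ q * (a ^ q + b ^ q) := by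
      gcongr
      rcases le_total a b with h | h
      · rw [max_eq_right h]; exact le_add_self
      · rw [max_eq_left h]; exact le_self_add

theorem lint_add_le {X : Type*} [MeasurableSpace X] {μ : Measure X} {q : ℝ} (hq : 0 < q)
    {f g : X → ℝ} (hf : AEStronglyMeasurable f μ) :
    ∫⁻ x, ‖f x + g x‖ₑ ^ q ∂μ ≤ 2 ^ q * (∫⁻ x, ‖f x‖ₑ ^ q ∂μ + ∫⁻ x, ‖g x‖ₑ ^ q ∂μ) := by
  have hm : AEMeasurable (fun x => ‖f x‖ₑ ^ q) μ := hf.enorm.pow_const q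
  rw [← lintegral_add_left' hm]
  rw [← lintegral_const_mul' _ _ (ENNReal.rpow_ne_top_of_nonneg hq.le (by simp))]
  apply lintegral_mono
  intro x
  exact le_trans (ENNReal.rpow_le_rpow (enorm_add_le _ _) hq.le) (rpow_add_le_two hq _ _)

theorem lint_zero_iff {X : Type*} [MeasurableSpace X] {μ : Measure X} {q : ℝ} (hq : 0 < q)
    {f : X → ℝ} (hf : AEStronglyMeasurable f μ) :
    ∫⁻ x, ‖f x‖ₑ ^ q ∂μ = 0 ↔ f =ᵐ[μ] 0 := by
  rw [lintegral_eq_zero_iff' (hf.enorm.pow_const q)]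
  constructor
  · intro h
    filter_upwards [h] with x hx
    simp only [Pi.zero_apply, ENNReal.rpow_eq_zero_iff, enorm_eq_zero] at hx
    rcases hx with hx | hx
    · exact hx.1
    · simp at hx
  · intro h
    filter_upwards [h] with x hx
    simp [hx, hq]

theorem dense_ind {X : Type*} [MeasurableSpace X] {μ : Measure X} {q : ℝ} (hq : 0 < q)
    (P : (X → ℝ) → Prop)
    (hind : ∀ (c : ℝ) (s : Set X), MeasurableSet s → μ s < ⊤ → P (s.indicator fun _ => c))
    (hadd : ∀ f g, P f → P g → P (f + g))
    (hae : ∀ f, P f → AEStronglyMeasurable f μ) {f : X → ℝ}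
    (hf : MemLp f (ENNReal.ofReal q) μ) {ε : ℝ≥0∞} (hε : ε ≠ 0) :
    ∃ g, ∫⁻ x, ‖f x - g x‖ₑ ^ q ∂μ ≤ ε ∧ P g := by
  have hε' : ε ^ (1 / q) ≠ 0 := by
    intro h
    rw [ENNReal.rpow_eq_zero_iff] at h
    rcases h with h | h
    · exact hε h.1
    · have : 0 < 1 / q := by positivity
      linarith [h.2]
  obtain ⟨g, hg, hP⟩ := MemLp.induction_dense (p := ENNReal.ofReal q) ENNReal.ofReal_ne_top P
    (fun c s hs hfin δ hδ => ⟨_, by simp, hind c s hs hfin⟩) hadd hae hf hε'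
  refine ⟨g, ?_, hP⟩
  have := eLpNorm_rpow_eq (μ := μ) hq (f - g)
  simp only [Pi.sub_apply] at this
  rw [← this]
  calc _ ≤ (ε ^ (1 / q)) ^ q := by gcongr
    _ = ε := by rw [← ENNReal.rpow_mul]; field_simp; simp

theorem lint_comp_mp {Y : Type*} [MeasurableSpace Y] {ν : Measure Y} {q : ℝ}
    {τ : Y → Y} (hτ : MeasurePreserving τ ν ν) {f : Y → ℝ} (hf : AEStronglyMeasurable f ν) :
    ∫⁻ y, ‖f (τ y)‖ₑ ^ q ∂ν = ∫⁻ y, ‖f y‖ₑ ^ q ∂ν := by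
  have hm : AEMeasurable (fun y => ‖f y‖ₑ ^ q) (Measure.map τ ν) := by
    rw [hτ.map_eq]; exact hf.enorm.pow_const q
  have := lintegral_map' hm hτ.measurable.aemeasurable
  rw [hτ.map_eq] at this
  rw [this]

theorem koopman_cont {G : Type*} [Group G] [TopologicalSpace G] {Y : Type*} [MeasurableSpace Y]
    {ν : Measure Y} (σ : PMPAction G ν) {q : ℝ} (hq : 0 < q) {f : Y → ℝ}
    (hf : MemLp f (ENNReal.ofReal q) ν) (g₀ : G) :
    Tendsto (fun g => ∫⁻ y, ‖f (σ.σ g y) - f (σ.σ g₀ y)‖ₑ ^ q ∂ν) (𝓝 g₀) (𝓝 0) := by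
  have hC : (2 : ℝ≥0∞) ^ q ≠ ⊤ := ENNReal.rpow_ne_top_of_nonneg hq.le (by simp)
  have hcomp : ∀ f : Y → ℝ, AEStronglyMeasurable f ν → ∀ g,
      AEStronglyMeasurable (fun y => f (σ.σ g y)) ν := fun f hf g =>
    hf.comp_measurePreserving (σ.measurePreserving g)
  rw [ENNReal.tendsto_nhds_zero]
  intro ε hε
  set C : ℝ≥0∞ := 2 ^ q with hCdef
  have hC0 : C ≠ 0 := by simp [hCdef]
  let ε' : ℝ≥0∞ := ε / (C + 2 * C * C)
  have hden : C + 2 * C * C ≠ ⊤ := by finiteness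
  have hden0 : C + 2 * C * C ≠ 0 := by simp [hC0]
  have hε' : ε' ≠ 0 := by
    simp only [ε', ne_eq, ENNReal.div_eq_zero_iff, not_or]
    exact ⟨hε.ne', hden⟩
  let P : (Y → ℝ) → Prop := fun f => AEStronglyMeasurable f ν ∧
    Tendsto (fun g => ∫⁻ y, ‖f (σ.σ g y) - f (σ.σ g₀ y)‖ₑ ^ q ∂ν) (𝓝 g₀) (𝓝 0)
  obtain ⟨k, hk, hkm, hkt⟩ := dense_ind hq P (μ := ν) (f := f) (ε := ε')
    (by
      intro c s hs hfin
      refine ⟨(measurable_const.indicator hs).aestronglyMeasurable, ?_⟩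
      have h1 := σ.continuous s hs hfin.ne g₀
      have h2 : ∀ g, ∫⁻ y, ‖s.indicator (fun _ => c) (σ.σ g y) - s.indicator (fun _ => c) (σ.σ g₀ y)‖ₑ ^ q ∂ν
          = ‖c‖ₑ ^ q * ν ((σ.σ g ⁻¹' s) ∆ (σ.σ g₀ ⁻¹' s)) := by
        intro g
        rw [← lintegral_indicator_const ((σ.measurable g hs).symmDiff (σ.measurable g₀ hs))]
        congr 1
        funext y
        by_cases h1 : σ.σ g y ∈ s <;> by_cases h2 : σ.σ g₀ y ∈ s <;>
          simp [h1, h2, Set.indicator, Set.mem_symmDiff, hq]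
      simp only [h2]
      have := ENNReal.Tendsto.const_mul (a := ‖c‖ₑ ^ q) h1
        (Or.inr (ENNReal.rpow_ne_top_of_nonneg hq.le (by simp)))
      simpa using this)
    (by
      rintro f f' ⟨hf, hft⟩ ⟨hf', hft'⟩
      refine ⟨hf.add hf', ?_⟩
      have h3 : Tendsto (fun g => C * ((∫⁻ y, ‖f (σ.σ g y) - f (σ.σ g₀ y)‖ₑ ^ q ∂ν) +
          ∫⁻ y, ‖f' (σ.σ g y) - f' (σ.σ g₀ y)‖ₑ ^ q ∂ν)) (𝓝 g₀) (𝓝 0) := by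
        have := ENNReal.Tendsto.const_mul (a := C) (hft.add hft') (Or.inr hC)
        simpa using this
      refine tendsto_of_tendsto_of_tendsto_of_le_of_le tendsto_const_nhds h3 (fun _ => zero_le) ?_
      intro g
      refine le_trans (le_of_eq ?_) (lint_add_le hq ((hcomp f hf g).sub (hcomp f hf g₀)))
      refine lintegral_congr fun y => ?_
      simp only [Pi.add_apply]
      congr 2; ring)
    (fun f hf => hf.1) hf hε'
  rw [ENNReal.tendsto_nhds_zero] at hkt
  filter_upwards [hkt ε' (pos_iff_ne_zero.mpr hε')] with g hg
  have hfm := hf.1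
  have e1 : ∀ g, ∫⁻ y, ‖f (σ.σ g y) - k (σ.σ g y)‖ₑ ^ q ∂ν ≤ ε' := fun g => by
    rw [lint_comp_mp (σ.measurePreserving g) (f := fun y => f y - k y) (hfm.sub hkm)]
    exact hk
  have e2 : ∫⁻ y, ‖k (σ.σ g₀ y) - f (σ.σ g₀ y)‖ₑ ^ q ∂ν ≤ ε' := by
    refine le_trans (le_of_eq ?_) (e1 g₀)
    congr 1; funext y; rw [← enorm_neg]; congr 2; ring
  calc ∫⁻ y, ‖f (σ.σ g y) - f (σ.σ g₀ y)‖ₑ ^ q ∂ν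
      = ∫⁻ y, ‖(k (σ.σ g y) - k (σ.σ g₀ y)) + ((f (σ.σ g y) - k (σ.σ g y)) +
          (k (σ.σ g₀ y) - f (σ.σ g₀ y)))‖ₑ ^ q ∂ν := by
        congr 1; funext y; congr 2; ring
    _ ≤ C * (∫⁻ y, ‖k (σ.σ g y) - k (σ.σ g₀ y)‖ₑ ^ q ∂ν + ∫⁻ y, ‖(f (σ.σ g y) - k (σ.σ g y)) +
          (k (σ.σ g₀ y) - f (σ.σ g₀ y))‖ₑ ^ q ∂ν) :=
        lint_add_le hq ((hcomp k hkm g).sub (hcomp k hkm g₀))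
    _ ≤ C * (ε' + C * (ε' + ε')) := by
        gcongr
        refine (lint_add_le hq ((hcomp f hfm g).sub (hcomp k hkm g))).trans ?_
        gcongr
        exact e1 g
    _ = (C + 2 * C * C) * ε' := by ring
    _ = ε := ENNReal.mul_div_cancel hden0 hden

/-- Construction of the affine action from a coboundary-type cocycle. -/
theorem build_beta {G : Type*} [Group G] [TopologicalSpace G] [IsTopologicalGroup G]
    {Y : Type*} [MeasurableSpace Y] {ν : Measure Y} (σ : PMPAction G ν) {q : ℝ} (hq : 0 < q)
    (ψ : G → NNReal) (hψ : Continuous ψ) (h₀ : Y → ℝ) (hm : Measurable h₀)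
    (hL : ∀ g : G, MemLp (fun y => h₀ (σ.σ g⁻¹ y) - h₀ y) (ENNReal.ofReal q) ν)
    (hval : ∀ g : G, (ψ g : ℝ≥0∞) = ∫⁻ y, ‖h₀ (σ.σ g⁻¹ y) - h₀ y‖ₑ ^ q ∂ν) :
    ∃ β : AffineIsometricAction G ν q,
      (∀ (g : G) (f : Lp ℝ (ENNReal.ofReal q) ν),
        (β.act g f : Y →ₘ[ν] ℝ) - (β.act g 0 : Y →ₘ[ν] ℝ)
          = (f : Y →ₘ[ν] ℝ).compMeasurePreserving (σ.σ g⁻¹) (σ.measurePreserving g⁻¹)) ∧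
      (∀ g : G, (ψ g : ℝ≥0∞) = pPow ν q ((β.act g 0 : Y →ₘ[ν] ℝ))) := by
  let bb : G → Lp ℝ (ENNReal.ofReal q) ν := fun g => (hL g).toLp _
  let A : G → Lp ℝ (ENNReal.ofReal q) ν → Lp ℝ (ENNReal.ofReal q) ν := fun g f =>
    Lp.compMeasurePreservingₗ ℝ (σ.σ g⁻¹) (σ.measurePreserving g⁻¹) f + bb g
  have hbb : ∀ g, bb g =ᵐ[ν] fun y => h₀ (σ.σ g⁻¹ y) - h₀ y := fun g => MemLp.coeFn_toLp _
  have hAf : ∀ g f, A g f =ᵐ[ν] fun y => f (σ.σ g⁻¹ y) + (h₀ (σ.σ g⁻¹ y) - h₀ y) := by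
    intro g f
    have h1 := Lp.coeFn_add (Lp.compMeasurePreservingₗ ℝ (σ.σ g⁻¹) (σ.measurePreserving g⁻¹) f) (bb g)
    have h2 := Lp.coeFn_compMeasurePreserving f (σ.measurePreserving g⁻¹)
    filter_upwards [h1, h2, hbb g] with y h1 h2 h3
    change (Lp.compMeasurePreservingₗ ℝ (σ.σ g⁻¹) (σ.measurePreserving g⁻¹) f + bb g : Lp ℝ (ENNReal.ofReal q) ν) y = _
    rw [h1, Pi.add_apply, h3]
    congr 1
  have hσmul : ∀ g h, σ.σ (g * h)⁻¹ =ᵐ[ν] σ.σ h⁻¹ ∘ σ.σ g⁻¹ := fun g h => by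
    rw [mul_inv_rev]; exact σ.σ_mul _ _
  have hσ1 : σ.σ (1 : G)⁻¹ =ᵐ[ν] id := by rw [inv_one]; exact σ.σ_one
  have qmp : ∀ g, Measure.QuasiMeasurePreserving (σ.σ g) ν ν := fun g =>
    (σ.measurePreserving g).quasiMeasurePreserving
  have hsub : ∀ (f f' : Lp ℝ (ENNReal.ofReal q) ν),
      ((f : Y →ₘ[ν] ℝ) - (f' : Y →ₘ[ν] ℝ) : Y →ₘ[ν] ℝ) =ᵐ[ν] fun y => f y - f' y := fun f f' =>
    AEEqFun.coeFn_sub _ _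
  have hψ1 : ψ 1 = 0 := by
    have h1 := hval 1
    have : ∫⁻ y, ‖h₀ (σ.σ (1 : G)⁻¹ y) - h₀ y‖ₑ ^ q ∂ν = ∫⁻ y, 0 ∂ν := by
      apply lintegral_congr_ae
      filter_upwards [hσ1] with y hy
      rw [hy]; simp [hq]
    rw [this] at h1
    simpa using h1
  have hcomp : ∀ f : Y → ℝ, AEStronglyMeasurable f ν → ∀ g,
      AEStronglyMeasurable (fun y => f (σ.σ g y)) ν := fun f hf g =>
    hf.comp_measurePreserving (σ.measurePreserving g)
  have hbdiff : ∀ g g₀, ∫⁻ y, ‖h₀ (σ.σ g⁻¹ y) - h₀ (σ.σ g₀⁻¹ y)‖ₑ ^ q ∂ν = ψ (g₀⁻¹ * g) := by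
    intro g g₀
    rw [hval]
    rw [← lint_comp_mp (σ.measurePreserving g₀⁻¹) (hL (g₀⁻¹ * g)).1]
    apply lintegral_congr_ae
    have := hσmul g₀ (g₀⁻¹ * g)
    rw [mul_inv_cancel_left] at this
    filter_upwards [this] with y hy
    rw [hy]; rfl
  refine ⟨⟨A, ?_, ?_, ?_, ?_, ?_⟩, ?_, ?_⟩
  · intro f
    apply Lp.ext
    filter_upwards [hAf 1 f, hσ1] with y h1 h2
    rw [h1, h2]; simp
  · intro g h f
    apply Lp.ext
    filter_upwards [hAf (g * h) f, hAf g (A h f), hσmul g h, (qmp g⁻¹).ae (hAf h f)] with y h1 h2 h3 h4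
    rw [h1, h2, h4, h3]; simp only [Function.comp_apply]; ring
  · intro g f f'
    rw [pPow_congr (f := fun y => f (σ.σ g⁻¹ y) - f' (σ.σ g⁻¹ y)), pPow_congr (hsub f f')]
    · exact lint_comp_mp (σ.measurePreserving g⁻¹) (f := fun y => f y - f' y)
        ((Lp.aestronglyMeasurable f).sub (Lp.aestronglyMeasurable f'))
    · filter_upwards [hsub (A g f) (A g f'), hAf g f, hAf g f'] with y h1 h2 h3
      rw [h1, h2, h3]; ring
  · intro g t f f'
    change _ + _ = t • (_ + _) + (1 - t) • (_ + _)
    rw [map_add, map_smul, map_smul]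
    module
  · intro f g₀
    have hC : (2 : ℝ≥0∞) ^ q ≠ ⊤ := ENNReal.rpow_ne_top_of_nonneg hq.le (by simp)
    have h1 := (koopman_cont σ hq (Lp.memLp f) g₀⁻¹).comp (tendsto_inv (G := G) g₀)
    have h2 : Tendsto (fun g => (ψ (g₀⁻¹ * g) : ℝ≥0∞)) (𝓝 g₀) (𝓝 0) := by
      have : Continuous (fun g => (ψ (g₀⁻¹ * g) : ℝ≥0∞)) := by fun_prop
      have := this.tendsto g₀
      simpa [hψ1] using this
    have h3 := ENNReal.Tendsto.const_mul (a := 2 ^ q) (h1.add h2) (Or.inr hC)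
    simp only [add_zero, mul_zero] at h3
    refine tendsto_of_tendsto_of_tendsto_of_le_of_le tendsto_const_nhds h3 (fun _ => zero_le) ?_
    intro g
    have he : pPow ν q ((A g f : Y →ₘ[ν] ℝ) - (A g₀ f : Y →ₘ[ν] ℝ)) =
        ∫⁻ y, ‖(f (σ.σ g⁻¹ y) - f (σ.σ g₀⁻¹ y)) + (h₀ (σ.σ g⁻¹ y) - h₀ (σ.σ g₀⁻¹ y))‖ₑ ^ q ∂ν := by
      apply pPow_congr
      filter_upwards [hsub (A g f) (A g₀ f), hAf g f, hAf g₀ f] with y h1 h2 h3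
      rw [h1, h2, h3]; ring
    simp only [Function.comp_apply]
    rw [he, ← hbdiff]
    exact lint_add_le hq ((hcomp f (Lp.aestronglyMeasurable f) _).sub
      (hcomp f (Lp.aestronglyMeasurable f) _))
  · intro g f
    apply AEEqFun.ext
    filter_upwards [hsub (A g f) (A g 0), hAf g f, hAf g 0,
      AEEqFun.coeFn_compMeasurePreserving (f : Y →ₘ[ν] ℝ) (σ.measurePreserving g⁻¹),
      (qmp g⁻¹).ae (Lp.coeFn_zero ℝ (ENNReal.ofReal q) ν)] with y h1 h2 h3 h4 h5
    rw [h1, h2, h3, h4, h5]; simp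
  · intro g
    rw [hval g]
    refine (pPow_congr ?_).symm
    filter_upwards [hAf g 0, (qmp g⁻¹).ae (Lp.coeFn_zero ℝ (ENNReal.ofReal q) ν)] with y h3 h5
    rw [h3, h5]; simp

end

section
open Filter Topology

/-- A nonsingular action together with multiplicative and additive cocycles. -/
structure SkewData (G : Type*) [Group G] [TopologicalSpace G] {X : Type*} [MeasurableSpace X]
    (m : Measure X) (p : ℝ) (ψ : G → NNReal) where
  S : G → X → X
  F : G → X → ℝ
  b : G → X → ℝ
  hS : ∀ g, Measurable (S g)
  hF : ∀ g, Measurable (F g)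
  hb : ∀ g, Measurable (b g)
  F_ne : ∀ g x, F g x ≠ 0
  map_eq : ∀ g, ∀ u : X → ℝ≥0∞, Measurable u →
    ∫⁻ x, ENNReal.ofReal (|F g x| ^ p) * u (S g x) ∂m = ∫⁻ x, u x ∂m
  S_one : S 1 =ᵐ[m] id
  F_one : F 1 =ᵐ[m] fun _ => 1
  b_one : b 1 =ᵐ[m] fun _ => 0
  S_mul : ∀ g h, S (g * h) =ᵐ[m] fun x => S h (S g x)
  F_mul : ∀ g h, F (g * h) =ᵐ[m] fun x => F g x * F h (S g x)
  b_mul : ∀ g h, b (g * h) =ᵐ[m] fun x => b g x + F g x * b h (S g x)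
  val : ∀ g, (ψ g : ℝ≥0∞) = ∫⁻ x, ‖b g x‖ₑ ^ p ∂m
  contF : ∀ g₀ (B : Set X), MeasurableSet B → Tendsto (fun g =>
    ∫⁻ x, ‖F g x * B.indicator (fun _ => 1) (S g x) - F g₀ x * B.indicator (fun _ => 1) (S g₀ x)‖ₑ ^ p ∂m)
    (𝓝 g₀) (𝓝 0)
  contb : ∀ g₀, Tendsto (fun g => ∫⁻ x, ‖b g x - b g₀ x‖ₑ ^ p ∂m) (𝓝 g₀) (𝓝 0)

namespace SkewData
variable {G : Type*} [Group G] [TopologicalSpace G] {X : Type*} [MeasurableSpace X]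
    {m : Measure X} {p : ℝ} {ψ : G → NNReal} (D : SkewData G m p ψ)

/-- the skew product map -/
noncomputable def tau (g : G) (y : X × (ℝ × ℝ)) : X × (ℝ × ℝ) :=
  (D.S g y.1, ((y.2.1 - D.b g y.1) / D.F g y.1, y.2.2 - Real.log |D.F g y.1|))

theorem tau_meas (g : G) : Measurable (D.tau g) := by
  have h1 := D.hS g
  have h2 := D.hF g
  have h3 := D.hb g
  have h4 : Measurable (fun x => |D.F g x|) := continuous_abs.measurable.comp h2
  unfold tau
  fun_prop

theorem tau_mp [SFinite m] (g : G) :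
    MeasurePreserving (D.tau g) (m.prod (fibM p)) (m.prod (fibM p)) := by
  refine ⟨D.tau_meas g, ?_⟩
  refine Measure.ext_of_lintegral _ ?_
  intro u hu
  rw [lintegral_map hu (D.tau_meas g), lintegral_prod (fun y => u (D.tau g y)) (hu.comp (D.tau_meas g)).aemeasurable,
    lintegral_prod _ hu.aemeasurable]
  have : ∀ x, ∫⁻ z, u (D.tau g (x, z)) ∂(fibM p)
      = ENNReal.ofReal (|D.F g x| ^ p) * ∫⁻ z, u (D.S g x, z) ∂(fibM p) := by
    intro x
    exact fibM_scale p (D.b g x) (D.F g x) (D.F_ne g x) (fun z => u (D.S g x, z)) (by fun_prop)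
  simp only [this]
  exact D.map_eq g (fun x => ∫⁻ z, u (x, z) ∂(fibM p)) hu.lintegral_prod_right'

theorem tau_one [SFinite m] : D.tau 1 =ᵐ[m.prod (fibM p)] id := by
  have q := Measure.quasiMeasurePreserving_fst (μ := m) (ν := fibM p)
  filter_upwards [q.ae D.S_one, q.ae D.F_one, q.ae D.b_one] with y h1 h2 h3
  simp [tau, h1, h2, h3]

theorem tau_mul [SFinite m] (g h : G) :
    D.tau (g * h) =ᵐ[m.prod (fibM p)] D.tau h ∘ D.tau g := by
  have q := Measure.quasiMeasurePreserving_fst (μ := m) (ν := fibM p)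
  filter_upwards [q.ae (D.S_mul g h), q.ae (D.F_mul g h), q.ae (D.b_mul g h)] with y h1 h2 h3
  simp only [tau, h1, h2, h3, Function.comp_apply]
  have n1 := D.F_ne g y.1
  have n2 := D.F_ne h (D.S g y.1)
  congr 2
  · field_simp
    ring
  · rw [abs_mul, Real.log_mul (abs_ne_zero.mpr n1) (abs_ne_zero.mpr n2)]
    ring

theorem lamM_Ioo_lt_top (p a b : ℝ) : lamM p (Set.Ioo a b) < ⊤ := by
  unfold lamM
  rw [withDensity_apply _ measurableSet_Ioo]
  have hi : IntegrableOn (fun r : ℝ => Real.exp ((p - 1) * r)) (Set.Ioo a b) := by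
    have : Continuous (fun r : ℝ => Real.exp ((p - 1) * r)) := by fun_prop
    exact (this.integrableOn_Icc).mono_set Set.Ioo_subset_Icc_self
  exact hi.lintegral_lt_top

theorem tau_cont [IsFiniteMeasure m] (hp : 0 < p) (g₀ : G) (A : Set (X × (ℝ × ℝ)))
    (hA : MeasurableSet A) (hfin : (m.prod (fibM p)) A ≠ ⊤) :
    Tendsto (fun g => (m.prod (fibM p)) ((D.tau g ⁻¹' A) ∆ (D.tau g₀ ⁻¹' A))) (𝓝 g₀) (𝓝 0) := by
  refine aux_cont_of_pi D.tau D.tau_mp g₀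
    (Set.image2 (· ×ˢ ·) {s : Set X | MeasurableSet s} {t : Set (ℝ × ℝ) | IsOpen t}) ?_ ?_
    (fun n : ℕ => Set.univ ×ˢ (Set.Ioo (-(n : ℝ)) n ×ˢ Set.Ioo (-(n : ℝ)) n)) ?_ ?_ ?_ ?_ ?_ A hA hfin
  · have h1 : MeasurableSpace.generateFrom {t : Set (ℝ × ℝ) | IsOpen t} = Prod.instMeasurableSpace :=
      (BorelSpace.measurable_eq (α := ℝ × ℝ)).symm
    have := generateFrom_eq_prod (α := X) (C := {s : Set X | MeasurableSet s})
      (D := {t : Set (ℝ × ℝ) | IsOpen t}) MeasurableSpace.generateFrom_measurableSet h1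
      ⟨fun _ => Set.univ, by simp, by simp [Set.iUnion_const]⟩
      ⟨fun _ => Set.univ, by simp, by simp [Set.iUnion_const]⟩
    exact this.symm
  · exact MeasurableSpace.isPiSystem_measurableSet.prod isPiSystem_isOpen
  · intro n
    exact ⟨Set.univ, MeasurableSet.univ, _, isOpen_Ioo.prod isOpen_Ioo, rfl⟩
  · intro n
    simp only [fibM, Measure.prod_prod, Real.volume_Ioo]
    have := lamM_Ioo_lt_top p (-(n : ℝ)) n
    finiteness
  · intro n n' h
    have h' : (n : ℝ) ≤ n' := by exact_mod_cast h
    have : Set.Ioo (-(n : ℝ)) n ⊆ Set.Ioo (-(n' : ℝ)) n' := Set.Ioo_subset_Ioo (by linarith) h'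
    exact Set.prod_mono subset_rfl (Set.prod_mono this this)
  · rw [Set.eq_univ_iff_forall]
    rintro ⟨x, a, r⟩
    obtain ⟨n, hn⟩ := exists_nat_gt (max |a| |r|)
    rw [max_lt_iff, abs_lt, abs_lt] at hn
    simp only [Set.mem_iUnion, Set.mem_prod, Set.mem_univ, true_and]
    exact ⟨n, hn.1, hn.2⟩
  · rintro _ ⟨B, hB, O, hO, rfl⟩ hfin
    simp only at hfin ⊢
    have hO : IsOpen O := hO
    have hB : MeasurableSet B := hB
    have hc := ((D.contF g₀ Set.univ MeasurableSet.univ).add (D.contF g₀ B hB)).add (D.contb g₀)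
    simp only [add_zero] at hc
    refine aux_tendsto_of_subseq hc ?_
    intro g hg
    have mB : Measurable (B.indicator (fun _ => (1 : ℝ))) := measurable_const.indicator hB
    have mU : ∀ g, Measurable (fun x => ‖D.F g x * Set.univ.indicator (fun _ => (1 : ℝ)) (D.S g x)
        - D.F g₀ x * Set.univ.indicator (fun _ => (1 : ℝ)) (D.S g₀ x)‖ₑ ^ p) := by
      intro g
      have h1 := D.hF g
      have h2 := D.hF g₀
      simp only [Set.indicator_univ, mul_one]
      fun_prop
    have mV : ∀ g, Measurable (fun x => ‖D.F g x * B.indicator (fun _ => (1 : ℝ)) (D.S g x)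
        - D.F g₀ x * B.indicator (fun _ => (1 : ℝ)) (D.S g₀ x)‖ₑ ^ p) := by
      intro g
      have h1 := D.hF g
      have h2 := D.hF g₀
      have h3 := mB.comp (D.hS g)
      have h4 := mB.comp (D.hS g₀)
      simp only [Function.comp_def] at h3 h4
      fun_prop
    have mW : ∀ g, Measurable (fun x => ‖D.b g x - D.b g₀ x‖ₑ ^ p) := by
      intro g
      have h1 := D.hb g
      have h2 := D.hb g₀
      fun_prop
    obtain ⟨φ, hφ⟩ := aux_ae_subseq (μ := m) (fun n x =>
      ‖D.F (g n) x * Set.univ.indicator (fun _ => (1 : ℝ)) (D.S (g n) x)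
        - D.F g₀ x * Set.univ.indicator (fun _ => (1 : ℝ)) (D.S g₀ x)‖ₑ ^ p
      + ‖D.F (g n) x * B.indicator (fun _ => (1 : ℝ)) (D.S (g n) x)
        - D.F g₀ x * B.indicator (fun _ => (1 : ℝ)) (D.S g₀ x)‖ₑ ^ p
      + ‖D.b (g n) x - D.b g₀ x‖ₑ ^ p)
      (fun n => (((mU (g n)).add (mV (g n))).add (mW (g n))).aemeasurable)
      (by
        refine hg.congr ?_
        intro n
        rw [lintegral_add_right _ (mW (g n)), lintegral_add_left (mU (g n))])
    refine ⟨φ, ?_⟩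
    refine aux_symmDiff_tendsto (fun k => D.tau (g (φ k))) (D.tau g₀) (fun k => D.tau_mp _)
      (D.tau_mp _) (hB.prod hO.measurableSet) hfin ?_
    have q := Measure.quasiMeasurePreserving_fst (μ := m) (ν := fibM p)
    have aux : ∀ (v : ℕ → ℝ) (v₀ : ℝ) (w : ℕ → ℝ≥0∞), Tendsto w atTop (𝓝 0) →
        (∀ k, ‖v k - v₀‖ₑ ^ p ≤ w k) → Tendsto v atTop (𝓝 v₀) := by
      intro v v₀ w hw hle
      have h1 : Tendsto (fun k => ‖v k - v₀‖ₑ ^ p) atTop (𝓝 0) :=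
        tendsto_of_tendsto_of_tendsto_of_le_of_le tendsto_const_nhds hw (fun _ => zero_le) hle
      have h2 := h1.ennrpow_const (1 / p)
      rw [ENNReal.zero_rpow_of_pos (by positivity)] at h2
      have h3 : Tendsto (fun k => ‖v k - v₀‖ₑ) atTop (𝓝 0) := by
        refine h2.congr fun k => ?_
        rw [← ENNReal.rpow_mul, mul_one_div_cancel hp.ne', ENNReal.rpow_one]
      rw [tendsto_iff_edist_tendsto_0]
      simpa [edist_eq_enorm_sub] using h3
    filter_upwards [q.ae hφ] with y hy
    have t1 := aux (fun k => D.F (g (φ k)) y.1) (D.F g₀ y.1) _ hy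
      (fun k => by simp only [Set.indicator_univ, mul_one]; rw [add_assoc]; exact le_self_add)
    have t2 := aux (fun k => D.F (g (φ k)) y.1 * B.indicator (fun _ => (1 : ℝ)) (D.S (g (φ k)) y.1))
      (D.F g₀ y.1 * B.indicator (fun _ => (1 : ℝ)) (D.S g₀ y.1)) _ hy
      (fun k => by rw [add_assoc]; exact le_add_left le_self_add)
    have t3 := aux (fun k => D.b (g (φ k)) y.1) (D.b g₀ y.1) _ hy (fun k => le_add_self)
    rintro ⟨hyB, hyO⟩
    have n0 := D.F_ne g₀ y.1
    have c1 : ∀ᶠ k in atTop, D.S (g (φ k)) y.1 ∈ B := by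
      have hyB' : D.S g₀ y.1 ∈ B := hyB
      rw [Set.indicator_of_mem hyB', mul_one] at t2
      filter_upwards [t2.eventually_ne n0] with k hk
      by_contra hc
      rw [Set.indicator_of_notMem hc, mul_zero] at hk
      exact hk rfl
    have c2 : Tendsto (fun k => (D.tau (g (φ k)) y).2) atTop (𝓝 (D.tau g₀ y).2) := by
      refine Tendsto.prodMk_nhds ?_ ?_
      · exact (tendsto_const_nhds.sub t3).div t1 n0
      · exact tendsto_const_nhds.sub (t1.abs.log (abs_ne_zero.mpr n0))
    filter_upwards [c1, c2.eventually (hO.mem_nhds hyO)] with k h1 h2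
    exact ⟨h1, h2⟩

theorem main [IsTopologicalGroup G] [IsFiniteMeasure m] (D : SkewData G m p ψ)
    (hp : 0 < p) {q : ℝ} (hpq : p < q) :
    ∃ (σ : PMPAction G (m.prod (fibM p))) (h₀ : X × (ℝ × ℝ) → ℝ),
        Measurable h₀ ∧ (∃ C : ℝ, ∀ y, |h₀ y| ≤ C) ∧
        (∀ g : G, (ψ g : ℝ≥0∞) = ∫⁻ y, ‖h₀ (σ.σ g⁻¹ y) - h₀ y‖ₑ ^ q ∂(m.prod (fibM p))) := by
  have hq : 0 < q := hp.trans hpq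
  let σ : PMPAction G (m.prod (fibM p)) :=
    { σ := fun g => D.tau g⁻¹
      measurable := fun g => D.tau_meas _
      measurePreserving := fun g => D.tau_mp _
      σ_one := by simpa using D.tau_one
      σ_mul := fun g h => by simpa [mul_inv_rev] using D.tau_mul h⁻¹ g⁻¹
      continuous := fun A hA hfin g₀ =>
        (D.tau_cont hp g₀⁻¹ A hA hfin).comp (tendsto_inv (G := G) g₀) }
  have c0 := cst_ne_zero hp hpq
  have c1 := cst_ne_top hp hpq
  set κ : ℝ := (cst p q).toReal ^ (-(1 / q)) with hκ
  have hκ0 : 0 < κ := Real.rpow_pos_of_pos (ENNReal.toReal_pos c0 c1) _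
  refine ⟨σ, fun y => κ * tent (y.2.1 * Real.exp (-y.2.2)), ?_, ⟨κ, ?_⟩, ?_⟩
  · have := tent_cont.measurable
    fun_prop
  · intro y
    rw [abs_mul, abs_of_pos hκ0, abs_of_nonneg (tent_nonneg _)]
    have := tent_le_one (y.2.1 * Real.exp (-y.2.2))
    nlinarith
  · intro g
    have hdiff : ∀ y : X × (ℝ × ℝ), κ * tent ((σ.σ g⁻¹ y).2.1 * Real.exp (-(σ.σ g⁻¹ y).2.2)) -
        κ * tent (y.2.1 * Real.exp (-y.2.2)) = κ * kerD (D.b g y.1) y.2 := by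
      intro y
      have n0 := D.F_ne g y.1
      have hpos : 0 < |D.F g y.1| := abs_pos.mpr n0
      have : σ.σ g⁻¹ y = D.tau g y := by simp [σ]
      rw [this, ← mul_sub]
      congr 1
      unfold kerD tau
      congr 1
      apply tent_abs
      simp only
      rw [show -(y.2.2 - Real.log |D.F g y.1|) = Real.log |D.F g y.1| + -y.2.2 by ring,
        Real.exp_add, Real.exp_log hpos]
      simp only [abs_mul, abs_div, abs_abs]
      field_simp
    simp only [hdiff]
    have hmk : Measurable (fun y : X × (ℝ × ℝ) => ‖κ * kerD (D.b g y.1) y.2‖ₑ ^ q) := by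
      have h1 := tent_cont.measurable
      have h2 := D.hb g
      unfold kerD
      fun_prop
    rw [lintegral_prod _ hmk.aemeasurable]
    have hin : ∀ x, ∫⁻ z, ‖κ * kerD (D.b g x) z‖ₑ ^ q ∂(fibM p) = ‖D.b g x‖ₑ ^ p := by
      intro x
      have hm1 : Measurable (fun z => ‖kerD (D.b g x) z‖ₑ ^ q) := by
        have := kerD_meas (D.b g x); fun_prop
      simp only [enorm_mul]
      simp_rw [ENNReal.mul_rpow_of_nonneg _ _ hq.le]
      rw [lintegral_const_mul _ hm1, kerD_integral hp hq, mul_comm (ENNReal.ofReal _), ← mul_assoc]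
      have : ‖κ‖ₑ ^ q * cst p q = 1 := by
        rw [Real.enorm_eq_ofReal hκ0.le, hκ, ← ENNReal.ofReal_rpow_of_pos (ENNReal.toReal_pos c0 c1),
          ENNReal.ofReal_toReal c1, ← ENNReal.rpow_mul, show -(1 / q) * q = -1 by field_simp,
          ENNReal.rpow_neg_one, ENNReal.inv_mul_cancel c0 c1]
      rw [this, one_mul, Real.enorm_eq_ofReal_abs, ENNReal.ofReal_rpow_of_nonneg (abs_nonneg _) hp.le]
    simp only [hin]
    exact D.val g

theorem final {G : Type*} [Group G] [TopologicalSpace G] {X : Type} [MeasurableSpace X]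
    {m : Measure X} {p : ℝ} {ψ : G → NNReal}
    [IsTopologicalGroup G] [IsFiniteMeasure m] [StandardBorelSpace X] (D : SkewData G m p ψ)
    (hψ : Continuous ψ) (hp : 0 < p) {q : ℝ} (hpq : p < q) :
    ∃ (Y : Type) (_ : MeasurableSpace Y) (ν : Measure Y),
      StandardBorelSpace Y ∧ SigmaFinite ν ∧
      ∃ (σ : PMPAction G ν) (h₀ : Y → ℝ),
        Measurable h₀ ∧ (∃ C : ℝ, ∀ᵐ y ∂ν, |h₀ y| ≤ C) ∧
        (∀ g : G, MemLp (fun y => h₀ (σ.σ g⁻¹ y) - h₀ y) (ENNReal.ofReal q) ν) ∧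
        (∀ g : G, (ψ g : ℝ≥0∞) = ∫⁻ y, (‖h₀ (σ.σ g⁻¹ y) - h₀ y‖₊ : ℝ≥0∞) ^ q ∂ν) ∧
        ∃ β : AffineIsometricAction G ν q,
          (∀ (g : G) (f : Lp ℝ (ENNReal.ofReal q) ν),
            (β.act g f : Y →ₘ[ν] ℝ) - (β.act g 0 : Y →ₘ[ν] ℝ)
              = (f : Y →ₘ[ν] ℝ).compMeasurePreserving (σ.σ g⁻¹) (σ.measurePreserving g⁻¹)) ∧
          (∀ g : G, (ψ g : ℝ≥0∞) = pPow ν q ((β.act g 0 : Y →ₘ[ν] ℝ))) := by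
  have hq : 0 < q := hp.trans hpq
  obtain ⟨σ, h₀, hm, ⟨C, hC⟩, hval⟩ := D.main hp hpq
  have hL : ∀ g : G, MemLp (fun y => h₀ (σ.σ g⁻¹ y) - h₀ y) (ENNReal.ofReal q) (m.prod (fibM p)) := by
    intro g
    refine memLp_of_lint hq ?_ ?_
    · exact ((hm.comp (σ.measurable _)).sub hm).aestronglyMeasurable
    · rw [← hval g]; exact ENNReal.coe_ne_top
  exact ⟨X × (ℝ × ℝ), inferInstance, m.prod (fibM p), inferInstance, inferInstance, σ, h₀, hm,
    ⟨C, Eventually.of_forall hC⟩, hL, hval, build_beta σ hq ψ hψ h₀ hm hL hval⟩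

end SkewData

end

section
open Filter Topology

/-- Function-level affine isometric representation. -/
structure LinData (G : Type*) [Group G] [TopologicalSpace G] {X : Type*} [MeasurableSpace X]
    (m : Measure X) (p : ℝ) (ψ : G → NNReal) where
  U : G → (X → ℝ) → (X → ℝ)
  b : G → X → ℝ
  U_mem : ∀ g f, MemLp f (ENNReal.ofReal p) m → MemLp (U g f) (ENNReal.ofReal p) m
  U_congr : ∀ g f f', MemLp f (ENNReal.ofReal p) m → MemLp f' (ENNReal.ofReal p) m →
    f =ᵐ[m] f' → U g f =ᵐ[m] U g f'
  U_add : ∀ g f f', MemLp f (ENNReal.ofReal p) m → MemLp f' (ENNReal.ofReal p) m →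
    U g (f + f') =ᵐ[m] U g f + U g f'
  U_smul : ∀ g (c : ℝ) f, MemLp f (ENNReal.ofReal p) m → U g (c • f) =ᵐ[m] c • U g f
  U_iso : ∀ g f, MemLp f (ENNReal.ofReal p) m →
    ∫⁻ x, ‖U g f x‖ₑ ^ p ∂m = ∫⁻ x, ‖f x‖ₑ ^ p ∂m
  U_mul : ∀ g h f, MemLp f (ENNReal.ofReal p) m → U (g * h) f =ᵐ[m] U g (U h f)
  U_one : ∀ f, MemLp f (ENNReal.ofReal p) m → U 1 f =ᵐ[m] f
  b_mem : ∀ g, MemLp (b g) (ENNReal.ofReal p) m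
  b_one : b 1 =ᵐ[m] 0
  b_mul : ∀ g h, b (g * h) =ᵐ[m] b g + U g (b h)
  val : ∀ g, (ψ g : ℝ≥0∞) = ∫⁻ x, ‖b g x‖ₑ ^ p ∂m
  U_cont : ∀ g₀ f, MemLp f (ENNReal.ofReal p) m →
    Tendsto (fun g => ∫⁻ x, ‖U g f x - U g₀ f x‖ₑ ^ p ∂m) (𝓝 g₀) (𝓝 0)
  b_cont : ∀ g₀, Tendsto (fun g => ∫⁻ x, ‖b g x - b g₀ x‖ₑ ^ p ∂m) (𝓝 g₀) (𝓝 0)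

namespace AffineIsometricAction
variable {G : Type*} [Group G] [TopologicalSpace G] {X : Type*} [MeasurableSpace X]
    {μ : Measure X} {p : ℝ} (α : AffineIsometricAction G μ p)

/-- linear part -/
noncomputable def T (g : G) (f : Lp ℝ (ENNReal.ofReal p) μ) : Lp ℝ (ENNReal.ofReal p) μ :=
  α.act g f - α.act g 0

theorem T_smul (g : G) (c : ℝ) (f) : α.T g (c • f) = c • α.T g f := by
  have := α.affine g c f 0
  rw [smul_zero, add_zero] at this
  unfold T
  rw [this]
  module

theorem T_add (g : G) (f f') : α.T g (f + f') = α.T g f + α.T g f' := by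
  have h1 := α.affine g (1/2) ((2:ℝ) • f) ((2:ℝ) • f')
  have h2 : ((1/2:ℝ) • ((2:ℝ) • f) + (1 - 1/2 : ℝ) • ((2:ℝ) • f')) = f + f' := by module
  rw [h2] at h1
  have h3 := α.T_smul g 2 f
  have h4 := α.T_smul g 2 f'
  unfold T at *
  rw [sub_eq_iff_eq_add] at h3 h4
  rw [h1, h3, h4]
  module

theorem T_sub (g : G) (f f') : α.T g (f - f') = α.T g f - α.T g f' := by
  have h := α.T_add g f ((-1:ℝ) • f')
  rw [T_smul] at h
  simpa [sub_eq_add_neg] using h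

theorem T_mul (g h : G) (f) : α.T (g * h) f = α.T g (α.T h f) := by
  conv_rhs => rw [show α.T h f = α.act h f - α.act h 0 from rfl, T_sub]
  unfold T
  rw [α.act_mul, α.act_mul]
  abel

theorem T_one (f) : α.T 1 f = f := by
  unfold T
  rw [α.act_one, α.act_one, sub_zero]

theorem b_mul (g h : G) : α.act (g * h) 0 = α.act g 0 + α.T g (α.act h 0) := by
  unfold T
  rw [α.act_mul]
  abel

theorem T_iso (g : G) (f) : pPow μ p (α.T g f : X →ₘ[μ] ℝ) = pPow μ p (f : X →ₘ[μ] ℝ) := by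
  have := α.isometry g f 0
  unfold T
  rw [AddSubgroup.coe_sub, this]
  simp

theorem T_cont (hp : 0 < p) (f) (g₀ : G) :
    Tendsto (fun g => pPow μ p ((α.T g f - α.T g₀ f : Lp ℝ (ENNReal.ofReal p) μ) : X →ₘ[μ] ℝ))
      (𝓝 g₀) (𝓝 0) := by
  have hC : (2 : ℝ≥0∞) ^ p ≠ ⊤ := ENNReal.rpow_ne_top_of_nonneg hp.le (by simp)
  have h1 := ENNReal.Tendsto.const_mul (a := (2 : ℝ≥0∞) ^ p)
    ((α.continuous f g₀).add (α.continuous 0 g₀)) (Or.inr hC)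
  simp only [add_zero, mul_zero] at h1
  refine tendsto_of_tendsto_of_tendsto_of_le_of_le tendsto_const_nhds h1 (fun _ => zero_le) ?_
  intro g
  set u : Lp ℝ (ENNReal.ofReal p) μ := α.act g f - α.act g₀ f
  set v : Lp ℝ (ENNReal.ofReal p) μ := α.act g₀ 0 - α.act g 0
  set v' : Lp ℝ (ENNReal.ofReal p) μ := α.act g 0 - α.act g₀ 0 with hv'
  have e : α.T g f - α.T g₀ f = u + v := by simp only [T, u, v]; abel
  have e1 : pPow μ p (((α.T g f - α.T g₀ f : Lp ℝ (ENNReal.ofReal p) μ)) : X →ₘ[μ] ℝ)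
      = ∫⁻ x, ‖u x + v x‖ₑ ^ p ∂μ := by
    rw [e]
    exact pPow_congr (Lp.coeFn_add u v)
  have e2 : pPow μ p (v' : X →ₘ[μ] ℝ) = ∫⁻ x, ‖v x‖ₑ ^ p ∂μ := by
    have hvv : v' = -v := by simp [v, v']
    rw [hvv, pPow_congr (Lp.coeFn_neg v)]
    simp
  calc _ = ∫⁻ x, ‖u x + v x‖ₑ ^ p ∂μ := e1
    _ ≤ _ := lint_add_le hp (Lp.aestronglyMeasurable u)
    _ = _ := by
      rw [← e2, ← pPow_congr (F := (u : X →ₘ[μ] ℝ)) (f := u) EventuallyEq.rfl]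
      rfl

theorem exists_linData [StandardBorelSpace X] [SigmaFinite μ] (hp : 0 < p) (ψ : G → NNReal)
    (h : ∀ g : G, (ψ g : ℝ≥0∞) = pPow μ p ((α.act g 0 : X →ₘ[μ] ℝ))) :
    ∃ m : Measure X, IsFiniteMeasure m ∧ Nonempty (LinData G m p ψ) := by
  obtain ⟨k, kpos, km, kint⟩ := exists_pos_lintegral_lt_of_sigmaFinite μ (ε := 1) one_ne_zero
  let w : X → ℝ := fun x => (k x : ℝ) ^ (1 / p)
  have wpos : ∀ x, 0 < w x := fun x => Real.rpow_pos_of_pos (by exact_mod_cast kpos x) _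
  have wm : Measurable w := by fun_prop
  have wk : ∀ x, ‖w x‖ₑ ^ p = (k x : ℝ≥0∞) := by
    intro x
    rw [Real.enorm_eq_ofReal (wpos x).le, ENNReal.ofReal_rpow_of_pos (wpos x)]
    simp only [w]
    rw [← Real.rpow_mul (NNReal.coe_nonneg (k x)), one_div, inv_mul_cancel₀ hp.ne', Real.rpow_one]
    simp
  let m : Measure X := μ.withDensity (fun x => (k x : ℝ≥0∞))
  have kme : Measurable (fun x => (k x : ℝ≥0∞)) := by fun_prop
  have hfin : IsFiniteMeasure m := ⟨by
    simp only [m, withDensity_apply _ MeasurableSet.univ, Measure.restrict_univ]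
    exact kint.trans (by simp)⟩
  have ac1 : m ≪ μ := withDensity_absolutelyContinuous _ _
  have ac2 : μ ≪ m := withDensity_absolutelyContinuous' kme.aemeasurable
    (Eventually.of_forall fun x => by simpa using (kpos x).ne')
  have J : ∀ f : X → ℝ, ∫⁻ x, ‖f x‖ₑ ^ p ∂m = ∫⁻ x, ‖f x * w x‖ₑ ^ p ∂μ := by
    intro f
    simp only [m]
    rw [lintegral_withDensity_eq_lintegral_mul_non_measurable _ kme
      (Eventually.of_forall fun x => by simp)]
    refine lintegral_congr fun x => ?_
    rw [enorm_mul, ENNReal.mul_rpow_of_nonneg _ _ hp.le, wk, Pi.mul_apply, mul_comm]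
  have J' : ∀ f : X → ℝ, ∫⁻ x, ‖f x / w x‖ₑ ^ p ∂m = ∫⁻ x, ‖f x‖ₑ ^ p ∂μ := by
    intro f
    rw [J]
    refine lintegral_congr fun x => ?_
    rw [div_mul_cancel₀ _ (wpos x).ne']
  have mem1 : ∀ f, MemLp f (ENNReal.ofReal p) m → MemLp (fun x => f x * w x) (ENNReal.ofReal p) μ := by
    intro f hf
    refine memLp_of_lint hp ((hf.1.mono_ac ac2).mul wm.aestronglyMeasurable) ?_
    rw [← J]; exact lint_of_memLp hp hf
  have mem2 : ∀ f, MemLp f (ENNReal.ofReal p) μ → MemLp (fun x => f x / w x) (ENNReal.ofReal p) m := by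
    intro f hf
    refine memLp_of_lint hp ((hf.1.mono_ac ac1).div₀ wm.aestronglyMeasurable) ?_
    rw [J']; exact lint_of_memLp hp hf
  let enc : (X → ℝ) → Lp ℝ (ENNReal.ofReal p) μ := fun f =>
    open Classical in if hf : MemLp f (ENNReal.ofReal p) m then (mem1 f hf).toLp _ else 0
  let dec : Lp ℝ (ENNReal.ofReal p) μ → X → ℝ := fun f x => f x / w x
  have enc_coe : ∀ f, MemLp f (ENNReal.ofReal p) m → enc f =ᵐ[μ] fun x => f x * w x := by
    intro f hf
    simp only [enc, dif_pos hf]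
    exact MemLp.coeFn_toLp _
  have enc_ext : ∀ f (F : Lp ℝ (ENNReal.ofReal p) μ), MemLp f (ENNReal.ofReal p) m →
      (F =ᵐ[μ] fun x => f x * w x) → enc f = F := fun f F hf hF =>
    Lp.ext ((enc_coe f hf).trans hF.symm)
  have dec_mem : ∀ F, MemLp (dec F) (ENNReal.ofReal p) m := fun F => mem2 _ (Lp.memLp F)
  have enc_dec : ∀ F, enc (dec F) = F := by
    intro F
    refine enc_ext _ _ (dec_mem F) (Eventually.of_forall fun x => ?_)
    simp only [dec]
    rw [div_mul_cancel₀ _ (wpos x).ne']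
  have dec_enc : ∀ f, MemLp f (ENNReal.ofReal p) m → dec (enc f) =ᵐ[m] f := by
    intro f hf
    filter_upwards [ac1.ae_le (enc_coe f hf)] with x hx
    simp only [dec, hx]
    rw [mul_div_cancel_right₀ _ (wpos x).ne']
  have dec_add : ∀ F F', dec (F + F') =ᵐ[m] dec F + dec F' := by
    intro F F'
    filter_upwards [ac1.ae_le (Lp.coeFn_add F F')] with x hx
    simp only [dec, hx, Pi.add_apply]
    ring
  have dec_sub : ∀ F F', dec (F - F') =ᵐ[m] dec F - dec F' := by
    intro F F'
    filter_upwards [ac1.ae_le (Lp.coeFn_sub F F')] with x hx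
    simp only [dec, hx, Pi.sub_apply]
    ring
  have dec_smul : ∀ (c : ℝ) F, dec (c • F) =ᵐ[m] c • dec F := by
    intro c F
    filter_upwards [ac1.ae_le (Lp.coeFn_smul c F)] with x hx
    simp only [dec, hx, Pi.smul_apply, smul_eq_mul]
    ring
  have enc_add : ∀ f f', MemLp f (ENNReal.ofReal p) m → MemLp f' (ENNReal.ofReal p) m →
      enc (f + f') = enc f + enc f' := by
    intro f f' hf hf'
    refine enc_ext _ _ (hf.add hf') ?_
    filter_upwards [Lp.coeFn_add (enc f) (enc f'), enc_coe f hf, enc_coe f' hf'] with x h1 h2 h3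
    rw [h1, Pi.add_apply, h2, h3, Pi.add_apply]
    ring
  have enc_smul : ∀ (c : ℝ) f, MemLp f (ENNReal.ofReal p) m → enc (c • f) = c • enc f := by
    intro c f hf
    refine enc_ext _ _ (hf.const_smul c) ?_
    filter_upwards [Lp.coeFn_smul c (enc f), enc_coe f hf] with x h1 h2
    rw [h1, Pi.smul_apply, h2, Pi.smul_apply]
    simp only [smul_eq_mul]
    ring
  have dec_int : ∀ F : Lp ℝ (ENNReal.ofReal p) μ,
      ∫⁻ x, ‖dec F x‖ₑ ^ p ∂m = pPow μ p (F : X →ₘ[μ] ℝ) := by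
    intro F
    rw [pPow_congr (F := (F : X →ₘ[μ] ℝ)) (f := F) EventuallyEq.rfl]
    exact J' F
  have dec_int_sub : ∀ F F' : Lp ℝ (ENNReal.ofReal p) μ,
      ∫⁻ x, ‖dec F x - dec F' x‖ₑ ^ p ∂m = pPow μ p ((F - F' : Lp ℝ (ENNReal.ofReal p) μ) : X →ₘ[μ] ℝ) := by
    intro F F'
    rw [← dec_int]
    refine lintegral_congr_ae ?_
    filter_upwards [dec_sub F F'] with x hx
    rw [hx, Pi.sub_apply]
  refine ⟨m, hfin, ⟨{
    U := fun g f => dec (α.T g (enc f))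
    b := fun g => dec (α.act g 0)
    U_mem := fun g f _ => dec_mem _
    U_congr := ?_
    U_add := ?_
    U_smul := ?_
    U_iso := ?_
    U_mul := ?_
    U_one := ?_
    b_mem := fun g => dec_mem _
    b_one := ?_
    b_mul := ?_
    val := fun g => by rw [dec_int, h]
    U_cont := ?_
    b_cont := ?_ }⟩⟩
  · intro g f f' hf hf' hff
    have : enc f = enc f' := by
      refine enc_ext _ _ hf ((enc_coe f' hf').trans ?_)
      filter_upwards [ac2.ae_le hff] with x hx
      rw [hx]
    rw [this]
  · intro g f f' hf hf'
    rw [enc_add f f' hf hf', α.T_add]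
    exact dec_add _ _
  · intro g c f hf
    rw [enc_smul c f hf, α.T_smul]
    exact dec_smul _ _
  · intro g f hf
    rw [dec_int, α.T_iso, ← dec_int]
    refine lintegral_congr_ae ?_
    filter_upwards [dec_enc f hf] with x hx
    rw [hx]
  · intro g h f hf
    rw [enc_dec, α.T_mul]
  · intro f hf
    rw [α.T_one]
    exact dec_enc f hf
  · rw [α.act_one]
    filter_upwards [ac1.ae_le (Lp.coeFn_zero ℝ (ENNReal.ofReal p) μ)] with x hx
    change (0 : Lp ℝ (ENNReal.ofReal p) μ) x / w x = 0
    rw [hx]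
    simp
  · intro g h
    rw [enc_dec, α.b_mul]
    exact dec_add _ _
  · intro g₀ f hf
    simp only [dec_int_sub]
    exact α.T_cont hp _ g₀
  · intro g₀
    simp only [dec_int_sub]
    exact α.continuous 0 g₀

end AffineIsometricAction

end

section
open Filter Topology

theorem clark_lt {p : ℝ} (hp : 0 < p) (h2 : p < 2) (a b : ℝ) :
    |a + b| ^ p + |a - b| ^ p ≤ 2 * |a| ^ p + 2 * |b| ^ p ∧
    (|a + b| ^ p + |a - b| ^ p = 2 * |a| ^ p + 2 * |b| ^ p → a * b = 0) := by
  have key : ∀ t : ℝ, |t| ^ p = (t ^ 2) ^ (p / 2) := by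
    intro t
    rw [← sq_abs, ← Real.rpow_natCast, ← Real.rpow_mul (abs_nonneg t)]
    congr 1; push_cast; ring
  have hr0 : 0 < p / 2 := by positivity
  have hr1 : p / 2 < 1 := by linarith
  have hc := (Real.concaveOn_rpow hr0.le hr1.le).2 (show (a + b) ^ 2 ∈ Set.Ici (0 : ℝ) from sq_nonneg (a + b))
    (show (a - b) ^ 2 ∈ Set.Ici (0 : ℝ) from sq_nonneg (a - b))
    (show (0 : ℝ) ≤ 1 / 2 by norm_num) (show (0 : ℝ) ≤ 1 / 2 by norm_num) (by norm_num)
  simp only [smul_eq_mul] at hc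
  rw [show 1 / 2 * (a + b) ^ 2 + 1 / 2 * (a - b) ^ 2 = a ^ 2 + b ^ 2 by ring] at hc
  have h3 : (a ^ 2 + b ^ 2) ^ (p / 2) ≤ (a ^ 2) ^ (p / 2) + (b ^ 2) ^ (p / 2) :=
    Real.rpow_add_le_add_rpow (by positivity) (by positivity) hr0.le hr1.le
  simp only [key]
  refine ⟨by linarith, fun heq => ?_⟩
  by_contra hab
  have ha : a ≠ 0 := left_ne_zero_of_mul hab
  have hb : b ≠ 0 := right_ne_zero_of_mul hab
  have ha2 : 0 < a ^ 2 := by positivity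
  have hb2 : 0 < b ^ 2 := by positivity
  have e : ∀ t : ℝ, 0 < t → t ^ (p / 2) = t * t ^ (p / 2 - 1) := by
    intro t ht
    rw [← Real.rpow_one_add' ht.le (by linarith)]
    congr 1; ring
  have l1 : (a ^ 2 + b ^ 2) ^ (p / 2 - 1) < (a ^ 2) ^ (p / 2 - 1) :=
    Real.rpow_lt_rpow_of_neg ha2 (by linarith) (by linarith)
  have l2 : (a ^ 2 + b ^ 2) ^ (p / 2 - 1) < (b ^ 2) ^ (p / 2 - 1) :=
    Real.rpow_lt_rpow_of_neg hb2 (by linarith) (by linarith)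
  have : (a ^ 2 + b ^ 2) ^ (p / 2) < (a ^ 2) ^ (p / 2) + (b ^ 2) ^ (p / 2) := by
    rw [e _ (by positivity), e _ ha2, e _ hb2]
    nlinarith
  linarith

theorem clark_gt {p : ℝ} (h2 : 2 < p) (a b : ℝ) :
    2 * |a| ^ p + 2 * |b| ^ p ≤ |a + b| ^ p + |a - b| ^ p ∧
    (2 * |a| ^ p + 2 * |b| ^ p = |a + b| ^ p + |a - b| ^ p → a * b = 0) := by
  have key : ∀ t : ℝ, |t| ^ p = (t ^ 2) ^ (p / 2) := by
    intro t
    rw [← sq_abs, ← Real.rpow_natCast, ← Real.rpow_mul (abs_nonneg t)]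
    congr 1; push_cast; ring
  have hr1 : 1 < p / 2 := by linarith
  have hc := (convexOn_rpow hr1.le).2 (show (a + b) ^ 2 ∈ Set.Ici (0 : ℝ) from sq_nonneg (a + b))
    (show (a - b) ^ 2 ∈ Set.Ici (0 : ℝ) from sq_nonneg (a - b))
    (show (0 : ℝ) ≤ 1 / 2 by norm_num) (show (0 : ℝ) ≤ 1 / 2 by norm_num) (by norm_num)
  simp only [smul_eq_mul] at hc
  rw [show 1 / 2 * (a + b) ^ 2 + 1 / 2 * (a - b) ^ 2 = a ^ 2 + b ^ 2 by ring] at hc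
  have h3 : (a ^ 2) ^ (p / 2) + (b ^ 2) ^ (p / 2) ≤ (a ^ 2 + b ^ 2) ^ (p / 2) :=
    Real.add_rpow_le_rpow_add (by positivity) (by positivity) hr1.le
  simp only [key]
  refine ⟨by linarith, fun heq => ?_⟩
  by_contra hab
  have ha : a ≠ 0 := left_ne_zero_of_mul hab
  have hb : b ≠ 0 := right_ne_zero_of_mul hab
  have ha2 : 0 < a ^ 2 := by positivity
  have hb2 : 0 < b ^ 2 := by positivity
  have e : ∀ t : ℝ, 0 < t → t ^ (p / 2) = t * t ^ (p / 2 - 1) := by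
    intro t ht
    rw [← Real.rpow_one_add' ht.le (by linarith)]
    congr 1; ring
  have l1 : (a ^ 2) ^ (p / 2 - 1) < (a ^ 2 + b ^ 2) ^ (p / 2 - 1) :=
    Real.rpow_lt_rpow ha2.le (by linarith) (by linarith)
  have l2 : (b ^ 2) ^ (p / 2 - 1) < (a ^ 2 + b ^ 2) ^ (p / 2 - 1) :=
    Real.rpow_lt_rpow hb2.le (by linarith) (by linarith)
  have : (a ^ 2) ^ (p / 2) + (b ^ 2) ^ (p / 2) < (a ^ 2 + b ^ 2) ^ (p / 2) := by
    rw [e (a ^ 2 + b ^ 2) (by positivity), e _ ha2, e _ hb2]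
    nlinarith
  linarith

theorem enorm_rpow_ofReal {p : ℝ} (hp : 0 < p) (a : ℝ) :
    ‖a‖ₑ ^ p = ENNReal.ofReal (|a| ^ p) := by
  rw [Real.enorm_eq_ofReal_abs, ENNReal.ofReal_rpow_of_nonneg (abs_nonneg _) hp.le]

/-- A linear isometry on function level. -/
structure LpIso {X : Type*} [MeasurableSpace X] (m : Measure X) (p : ℝ)
    (U : (X → ℝ) → (X → ℝ)) : Prop where
  mem : ∀ f, MemLp f (ENNReal.ofReal p) m → MemLp (U f) (ENNReal.ofReal p) m
  congr : ∀ f f', MemLp f (ENNReal.ofReal p) m → MemLp f' (ENNReal.ofReal p) m →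
    f =ᵐ[m] f' → U f =ᵐ[m] U f'
  add : ∀ f f', MemLp f (ENNReal.ofReal p) m → MemLp f' (ENNReal.ofReal p) m →
    U (f + f') =ᵐ[m] U f + U f'
  smul : ∀ (c : ℝ) f, MemLp f (ENNReal.ofReal p) m → U (c • f) =ᵐ[m] c • U f
  iso : ∀ f, MemLp f (ENNReal.ofReal p) m → ∫⁻ x, ‖U f x‖ₑ ^ p ∂m = ∫⁻ x, ‖f x‖ₑ ^ p ∂m

namespace LpIso
variable {X : Type*} [MeasurableSpace X] {m : Measure X} {p : ℝ} {U : (X → ℝ) → (X → ℝ)}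

theorem sub (H : LpIso m p U) {f f' : X → ℝ} (hf : MemLp f (ENNReal.ofReal p) m)
    (hf' : MemLp f' (ENNReal.ofReal p) m) : U (f - f') =ᵐ[m] U f - U f' := by
  have h1 := H.add f ((-1 : ℝ) • f') hf (hf'.const_smul _)
  have h2 := H.smul (-1) f' hf'
  have e : f + (-1 : ℝ) • f' = f - f' := by
    ext x; simp [sub_eq_add_neg]
  rw [e] at h1
  filter_upwards [h1, h2] with x h1 h2
  rw [h1, Pi.add_apply, h2]
  simp [sub_eq_add_neg]

theorem iso_sub (H : LpIso m p U) {f f' : X → ℝ} (hf : MemLp f (ENNReal.ofReal p) m)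
    (hf' : MemLp f' (ENNReal.ofReal p) m) :
    ∫⁻ x, ‖U f x - U f' x‖ₑ ^ p ∂m = ∫⁻ x, ‖f x - f' x‖ₑ ^ p ∂m := by
  rw [← show ∫⁻ x, ‖U (f - f') x‖ₑ ^ p ∂m = ∫⁻ x, ‖f x - f' x‖ₑ ^ p ∂m from H.iso _ (hf.sub hf')]
  refine lintegral_congr_ae ?_
  filter_upwards [H.sub hf hf'] with x hx
  rw [hx, Pi.sub_apply]

theorem disj (H : LpIso m p U) (hp : 0 < p) (hp2 : p ≠ 2) {f f' : X → ℝ} (hf : MemLp f (ENNReal.ofReal p) m)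
    (hf' : MemLp f' (ENNReal.ofReal p) m) (h : ∀ᵐ x ∂m, f x * f' x = 0) :
    ∀ᵐ x ∂m, U f x * U f' x = 0 := by
  have msq : ∀ {f : X → ℝ}, MemLp f (ENNReal.ofReal p) m → AEMeasurable (fun x => ‖f x‖ₑ ^ p) m :=
    fun hf => hf.1.enorm.pow_const p
  -- the two integrals
  have e1 : ∫⁻ x, (‖U f x + U f' x‖ₑ ^ p + ‖U f x - U f' x‖ₑ ^ p) ∂m
      = ∫⁻ x, (‖f x + f' x‖ₑ ^ p + ‖f x - f' x‖ₑ ^ p) ∂m := by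
    have a1 : AEMeasurable (fun x => ‖U f x + U f' x‖ₑ ^ p) m := msq ((H.mem f hf).add (H.mem f' hf'))
    have a2 : AEMeasurable (fun x => ‖f x + f' x‖ₑ ^ p) m := msq (hf.add hf')
    rw [lintegral_add_left' a1, lintegral_add_left' a2, H.iso_sub hf hf']
    congr 1
    rw [← show ∫⁻ x, ‖U (f + f') x‖ₑ ^ p ∂m = ∫⁻ x, ‖f x + f' x‖ₑ ^ p ∂m from H.iso _ (hf.add hf')]
    refine lintegral_congr_ae ?_
    filter_upwards [H.add f f' hf hf'] with x hx
    rw [hx, Pi.add_apply]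
  have e2 : ∫⁻ x, (2 * ‖U f x‖ₑ ^ p + 2 * ‖U f' x‖ₑ ^ p) ∂m
      = ∫⁻ x, (2 * ‖f x‖ₑ ^ p + 2 * ‖f' x‖ₑ ^ p) ∂m := by
    rw [lintegral_add_left' ((msq (H.mem f hf)).const_mul _), lintegral_add_left' ((msq hf).const_mul _),
      lintegral_const_mul' _ _ (by simp), lintegral_const_mul' _ _ (by simp),
      lintegral_const_mul' _ _ (by simp), lintegral_const_mul' _ _ (by simp), H.iso f hf, H.iso f' hf']
  have e3 : ∫⁻ x, (‖f x + f' x‖ₑ ^ p + ‖f x - f' x‖ₑ ^ p) ∂m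
      = ∫⁻ x, (2 * ‖f x‖ₑ ^ p + 2 * ‖f' x‖ₑ ^ p) ∂m := by
    refine lintegral_congr_ae ?_
    filter_upwards [h] with x hx
    rcases mul_eq_zero.mp hx with h0 | h0
    · simp [h0, ENNReal.zero_rpow_of_pos hp, two_mul]
    · simp [h0, ENNReal.zero_rpow_of_pos hp, two_mul]
  have fin : ∫⁻ x, (2 * ‖f x‖ₑ ^ p + 2 * ‖f' x‖ₑ ^ p) ∂m ≠ ⊤ := by
    rw [lintegral_add_left' ((msq hf).const_mul _), lintegral_const_mul' _ _ (by simp),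
      lintegral_const_mul' _ _ (by simp)]
    have := lint_of_memLp hp hf
    have := lint_of_memLp hp hf'
    finiteness
  have E1 : ∀ a b : ℝ, ‖a + b‖ₑ ^ p + ‖a - b‖ₑ ^ p = ENNReal.ofReal (|a + b| ^ p + |a - b| ^ p) := by
    intro a b
    rw [enorm_rpow_ofReal hp, enorm_rpow_ofReal hp, ENNReal.ofReal_add (by positivity) (by positivity)]
  have E2 : ∀ a b : ℝ, 2 * ‖a‖ₑ ^ p + 2 * ‖b‖ₑ ^ p = ENNReal.ofReal (2 * |a| ^ p + 2 * |b| ^ p) := by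
    intro a b
    rw [enorm_rpow_ofReal hp, enorm_rpow_ofReal hp, ENNReal.ofReal_add (by positivity) (by positivity),
      ENNReal.ofReal_mul (by norm_num), ENNReal.ofReal_mul (by norm_num)]
    simp
  have m1 : AEMeasurable (fun x => ‖U f x + U f' x‖ₑ ^ p + ‖U f x - U f' x‖ₑ ^ p) m :=
    (msq ((H.mem f hf).add (H.mem f' hf'))).add (msq ((H.mem f hf).sub (H.mem f' hf')))
  have m2 : AEMeasurable (fun x => 2 * ‖U f x‖ₑ ^ p + 2 * ‖U f' x‖ₑ ^ p) m :=
    ((msq (H.mem f hf)).const_mul _).add ((msq (H.mem f' hf')).const_mul _)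
  rcases lt_or_gt_of_ne hp2 with h2 | h2
  · have := ae_eq_of_ae_le_of_lintegral_le (μ := m)
      (f := fun x => ‖U f x + U f' x‖ₑ ^ p + ‖U f x - U f' x‖ₑ ^ p)
      (g := fun x => 2 * ‖U f x‖ₑ ^ p + 2 * ‖U f' x‖ₑ ^ p)
      (Eventually.of_forall fun x => by
        simp only [E1, E2]; exact ENNReal.ofReal_le_ofReal (clark_lt hp h2 _ _).1)
      (by rw [e1, e3]; exact fin) m2 (by rw [e1, e2, e3])
    filter_upwards [this] with x hx
    rw [E1, E2, ENNReal.ofReal_eq_ofReal_iff (by positivity) (by positivity)] at hx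
    exact (clark_lt hp h2 _ _).2 hx
  · have := ae_eq_of_ae_le_of_lintegral_le (μ := m)
      (g := fun x => ‖U f x + U f' x‖ₑ ^ p + ‖U f x - U f' x‖ₑ ^ p)
      (f := fun x => 2 * ‖U f x‖ₑ ^ p + 2 * ‖U f' x‖ₑ ^ p)
      (Eventually.of_forall fun x => by
        simp only [E1, E2]; exact ENNReal.ofReal_le_ofReal (clark_gt h2 _ _).1)
      (by rw [e2]; exact fin) m1 (by rw [e1, e2, e3])
    filter_upwards [this] with x hx
    rw [E1, E2, ENNReal.ofReal_eq_ofReal_iff (by positivity) (by positivity)] at hx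
    exact (clark_gt h2 _ _).2 hx

end LpIso

end

section
open Filter Topology

namespace LpIso
variable {X : Type*} [MeasurableSpace X] {m : Measure X} {p : ℝ} {U : (X → ℝ) → (X → ℝ)}

/-- indicator function -/
noncomputable def ind {X : Type*} (A : Set X) : X → ℝ := A.indicator fun _ => 1

theorem ind_meas {A : Set X} (hA : MeasurableSet A) : Measurable (ind A) :=
  measurable_const.indicator hA

theorem ind_mem [IsFiniteMeasure m] {A : Set X} (hA : MeasurableSet A) :
    MemLp (ind A) (ENNReal.ofReal p) m :=
  memLp_indicator_const _ hA _ (Or.inr (measure_ne_top m A))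

theorem ind_of_mem {X : Type*} {A : Set X} {x : X} (h : x ∈ A) : ind A x = 1 := Set.indicator_of_mem h _
theorem ind_of_notMem {X : Type*} {A : Set X} {x : X} (h : x ∉ A) : ind A x = 0 :=
  Set.indicator_of_notMem h _

theorem ind_split {A C : Set X} (hAC : A ⊆ C) : ind A + ind (C \ A) = ind C := by
  ext x
  simp only [Pi.add_apply]
  by_cases hA : x ∈ A
  · rw [ind_of_mem hA, ind_of_mem (hAC hA), ind_of_notMem (A := C \ A) (fun h => h.2 hA)]; simp
  · by_cases hC : x ∈ C
    · rw [ind_of_notMem hA, ind_of_mem hC, ind_of_mem (A := C \ A) ⟨hC, hA⟩]; simp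
    · rw [ind_of_notMem hA, ind_of_notMem hC, ind_of_notMem (A := C \ A) (fun h => hC h.1)]; simp

theorem ind_int [IsFiniteMeasure m] (hp : 0 < p) {A : Set X} (hA : MeasurableSet A) :
    ∫⁻ x, ‖ind A x‖ₑ ^ p ∂m = m A := by
  rw [← lintegral_indicator_one hA]
  refine lintegral_congr fun x => ?_
  by_cases h : x ∈ A
  · simp [ind_of_mem h, h]
  · simp [ind_of_notMem h, h, ENNReal.zero_rpow_of_pos hp]

variable [IsFiniteMeasure m]

theorem split (H : LpIso m p U) (hp : 0 < p) (hp2 : p ≠ 2) {A C : Set X} (hA : MeasurableSet A)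
    (hC : MeasurableSet C) (hAC : A ⊆ C) :
    ∀ᵐ x ∂m, U (ind C) x = U (ind A) x + U (ind (C \ A)) x ∧
      U (ind A) x * U (ind (C \ A)) x = 0 := by
  have h1 := H.add (ind A) (ind (C \ A)) (ind_mem hA) (ind_mem (hC.diff hA))
  have h2 := H.disj hp hp2 (ind_mem hA) (ind_mem (hC.diff hA)) (Eventually.of_forall fun x => by
    by_cases h : x ∈ A
    · rw [ind_of_notMem (A := C \ A) (fun h' => h'.2 h), mul_zero]
    · rw [ind_of_notMem h, zero_mul])
  rw [ind_split hAC] at h1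
  filter_upwards [h1, h2] with x h1 h2
  exact ⟨h1, h2⟩

theorem mono (H : LpIso m p U) (hp : 0 < p) (hp2 : p ≠ 2) {A C : Set X} (hA : MeasurableSet A)
    (hC : MeasurableSet C) (hAC : A ⊆ C) :
    ∀ᵐ x ∂m, U (ind A) x ≠ 0 → U (ind C) x = U (ind A) x := by
  filter_upwards [H.split hp hp2 hA hC hAC] with x ⟨h1, h2⟩ h3
  have := (mul_eq_zero.mp h2).resolve_left h3
  rw [h1, this, add_zero]

/-- the class of sets on which `U` acts by composition -/
def good (m : Measure X) (U : (X → ℝ) → (X → ℝ)) (A N : Set X) : Prop :=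
  ∀ᵐ x ∂m, U (ind A) x = ind N x * U (ind Set.univ) x

theorem good_basic (H : LpIso m p U) (hp : 0 < p) (hp2 : p ≠ 2) {A : Set X} (hA : MeasurableSet A)
    {u : X → ℝ} (hu : u =ᵐ[m] U (ind A)) : good m U A {x | u x ≠ 0} := by
  filter_upwards [hu, H.mono hp hp2 hA MeasurableSet.univ (Set.subset_univ A)] with x h1 h2
  by_cases h : u x = 0
  · rw [ind_of_notMem (by simpa using h), ← h1, h, zero_mul]
  · rw [ind_of_mem h, one_mul, h2 (h1 ▸ h)]

theorem good_compl (H : LpIso m p U) (hp : 0 < p) (hp2 : p ≠ 2) {A N : Set X} (hA : MeasurableSet A)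
    (h : good m U A N) : good m U Aᶜ Nᶜ := by
  filter_upwards [h, H.split hp hp2 hA MeasurableSet.univ (Set.subset_univ A)] with x h1 ⟨h2, h3⟩
  have hc : Aᶜ = Set.univ \ A := Set.compl_eq_univ_sdiff A
  rw [hc]
  by_cases hN : x ∈ N
  · rw [ind_of_mem hN, one_mul] at h1
    rw [ind_of_notMem (A := Nᶜ) (fun h => h hN), zero_mul]
    linarith
  · rw [ind_of_notMem hN, zero_mul] at h1
    rw [ind_of_mem (A := Nᶜ) hN, one_mul]
    linarith

theorem good_union (H : LpIso m p U) (hp : 0 < p) (hp2 : p ≠ 2) {A B N N' : Set X}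
    (hA : MeasurableSet A) (hB : MeasurableSet B)
    (h : good m U A N) (h' : good m U B N') : good m U (A ∪ B) (N ∪ N') := by
  have hBA : (A ∪ B) \ A ⊆ B := by
    rintro x ⟨h | h, h'⟩
    · exact absurd h h'
    · exact h
  filter_upwards [h, h', H.split hp hp2 hA (hA.union hB) Set.subset_union_left,
    H.mono hp hp2 hA (hA.union hB) Set.subset_union_left,
    H.mono hp hp2 hB (hA.union hB) Set.subset_union_right,
    H.mono hp hp2 ((hA.union hB).diff hA) hB hBA,
    H.mono hp hp2 (hA.union hB) MeasurableSet.univ (Set.subset_univ _)] with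
    x h1 h2 ⟨h3, h3'⟩ h4 h5 h6 h7
  by_cases h0 : U (ind Set.univ) x = 0
  · rw [h0, mul_zero]
    by_contra hc
    exact hc (by rw [← h7 hc, h0])
  by_cases hN : x ∈ N
  · rw [ind_of_mem hN, one_mul] at h1
    rw [ind_of_mem (A := N ∪ N') (Or.inl hN), one_mul, h4 (h1 ▸ h0), h1]
  · by_cases hN' : x ∈ N'
    · rw [ind_of_mem hN', one_mul] at h2
      rw [ind_of_mem (A := N ∪ N') (Or.inr hN'), one_mul, h5 (h2 ▸ h0), h2]
    · rw [ind_of_notMem hN, zero_mul] at h1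
      rw [ind_of_notMem hN', zero_mul] at h2
      rw [ind_of_notMem (A := N ∪ N') (by simp [hN, hN']), zero_mul, h3, h1, zero_add]
      by_contra hc
      exact hc (by rw [← h6 hc, h2])

theorem good_iUnion (H : LpIso m p U) (hp : 0 < p) (hp2 : p ≠ 2) {A N : ℕ → Set X}
    (hA : ∀ n, MeasurableSet (A n)) (hN : ∀ n, MeasurableSet (N n))
    (h : ∀ n, good m U (A n) (N n)) : good m U (⋃ n, A n) (⋃ n, N n) := by
  let B : ℕ → Set X := fun n => ⋃ k ≤ n, A k
  let M : ℕ → Set X := fun n => ⋃ k ≤ n, N k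
  have hB : ∀ n, MeasurableSet (B n) := fun n => MeasurableSet.biUnion (Set.to_countable _) fun k _ => hA k
  have hM : ∀ n, MeasurableSet (M n) := fun n => MeasurableSet.biUnion (Set.to_countable _) fun k _ => hN k
  have hg : ∀ n, good m U (B n) (M n) := by
    intro n
    induction n with
    | zero => simpa [B, M] using h 0
    | succ n ih =>
      have e1 : B (n + 1) = B n ∪ A (n + 1) := Set.biUnion_le_succ A n
      have e2 : M (n + 1) = M n ∪ N (n + 1) := Set.biUnion_le_succ N n
      rw [e1, e2]
      exact H.good_union hp hp2 (hB n) (hA _) ih (h _)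
  have hAU := MeasurableSet.iUnion hA
  have hNU := MeasurableSet.iUnion hN
  have mUA := (H.mem _ (ind_mem (p := p) (m := m) hAU)).1
  have mU1 := (H.mem _ (ind_mem (p := p) (m := m) MeasurableSet.univ)).1
  have lim1 : Tendsto (fun n => ∫⁻ x, ‖U (ind (⋃ n, A n)) x - ind (M n) x * U (ind Set.univ) x‖ₑ ^ p ∂m)
      atTop (𝓝 0) := by
    have e : ∀ n, ∫⁻ x, ‖U (ind (⋃ n, A n)) x - ind (M n) x * U (ind Set.univ) x‖ₑ ^ p ∂m
        = m ((⋃ n, A n) \ B n) := by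
      intro n
      have hBs : B n ⊆ ⋃ n, A n := Set.iUnion₂_subset fun k _ => Set.subset_iUnion A k
      rw [← ind_int hp (hAU.diff (hB n))]
      have := H.iso_sub (ind_mem hAU) (ind_mem (hB n))
      rw [show ∫⁻ x, ‖ind ((⋃ n, A n) \ B n) x‖ₑ ^ p ∂m
        = ∫⁻ x, ‖ind (⋃ n, A n) x - ind (B n) x‖ₑ ^ p ∂m by
          refine lintegral_congr fun x => ?_
          rw [← ind_split hBs]; simp, ← this]
      refine lintegral_congr_ae ?_
      filter_upwards [hg n] with x hx
      rw [hx]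
    simp only [e]
    have := tendsto_measure_iInter_atTop (μ := m) (s := fun n => (⋃ n, A n) \ B n)
      (fun n => (hAU.diff (hB n)).nullMeasurableSet)
      (fun i j hij => Set.sdiff_subset_sdiff_right (Set.biUnion_subset_biUnion_left fun k (hk : k ≤ i) => hk.trans hij))
      ⟨0, measure_ne_top _ _⟩
    have hE : ⋂ n, ((⋃ n, A n) \ B n) = ∅ := by
      refine Set.eq_empty_of_forall_notMem fun x hx => ?_
      rw [Set.mem_iInter] at hx
      obtain ⟨k, hk⟩ := Set.mem_iUnion.mp (hx 0).1
      exact (hx k).2 (Set.mem_biUnion (show k ∈ {i | i ≤ k} from le_refl k) hk)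
    rw [hE, measure_empty] at this
    exact this
  have hmm : ∀ n, AEMeasurable
      (fun x => ‖U (ind (⋃ n, A n)) x - ind (M n) x * U (ind Set.univ) x‖ₑ ^ p) m := fun n =>
    (mUA.sub ((ind_meas (hM n)).aestronglyMeasurable.mul mU1)).enorm.pow_const p
  have fatou := lintegral_liminf_le' (u := atTop) hmm
  rw [lim1.liminf_eq] at fatou
  have pt : ∀ x, liminf (fun n => ‖U (ind (⋃ n, A n)) x - ind (M n) x * U (ind Set.univ) x‖ₑ ^ p) atTop
      = ‖U (ind (⋃ n, A n)) x - ind (⋃ n, N n) x * U (ind Set.univ) x‖ₑ ^ p := by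
    intro x
    refine Tendsto.liminf_eq ?_
    refine tendsto_const_nhds.congr' ?_
    by_cases hx : x ∈ ⋃ n, N n
    · obtain ⟨k, hk⟩ := Set.mem_iUnion.mp hx
      filter_upwards [eventually_ge_atTop k] with n hn
      rw [ind_of_mem hx, ind_of_mem (A := M n) (Set.mem_biUnion (show k ∈ {i | i ≤ n} from hn) hk)]
    · filter_upwards with n
      rw [ind_of_notMem hx, ind_of_notMem]
      intro h'
      exact hx (Set.iUnion₂_subset (fun k _ => Set.subset_iUnion N k) h')
  simp only [pt, nonpos_iff_eq_zero] at fatou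
  have := (lint_zero_iff hp (mUA.sub ((ind_meas hNU).aestronglyMeasurable.mul mU1))).mp fatou
  filter_upwards [this] with x hx
  simp only [Pi.sub_apply, Pi.mul_apply, Pi.zero_apply] at hx
  linarith

theorem lamperti [StandardBorelSpace X] (H : LpIso m p U) (hp : 0 < p) (hp2 : p ≠ 2)
    (hsurj : ∃ v, MemLp v (ENNReal.ofReal p) m ∧ U v =ᵐ[m] fun _ => 1) :
    ∃ (S : X → X) (F : X → ℝ), Measurable S ∧ Measurable F ∧ (∀ x, F x ≠ 0) ∧
      (∀ u : X → ℝ≥0∞, Measurable u →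
        ∫⁻ x, ENNReal.ofReal (|F x| ^ p) * u (S x) ∂m = ∫⁻ x, u x ∂m) ∧
      (∀ f, Measurable f → MemLp f (ENNReal.ofReal p) m → U f =ᵐ[m] fun x => F x * f (S x)) := by
  rcases isEmpty_or_nonempty X with hX | hX
  · refine ⟨id, fun _ => 1, measurable_id, measurable_const, by simp, fun u hu => by simp, ?_⟩
    intro f _ _
    exact Eventually.of_forall fun x => isEmptyElim x
  obtain ⟨e, em, einj⟩ := MeasurableSpace.measurable_injection_nat_bool_of_countablySeparated X
  have eemb : MeasurableEmbedding e := em.measurableEmbedding einj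
  obtain ⟨r, rm, hr⟩ := eemb.exists_measurable_extend measurable_id (fun _ => hX)
  have hr' : ∀ x, r (e x) = x := fun x => congrFun hr x
  let A : ℕ → Set X := fun n => {x | e x n = true}
  have hA : ∀ n, MeasurableSet (A n) := fun n =>
    ((measurable_pi_apply n).comp em) (measurableSet_singleton true)
  have hUA := fun n => (H.mem _ (ind_mem (p := p) (m := m) (hA n))).1
  have hU1 := (H.mem _ (ind_mem (p := p) (m := m) MeasurableSet.univ)).1
  let u : ℕ → X → ℝ := fun n => (hUA n).mk _
  have um : ∀ n, Measurable (u n) := fun n => (hUA n).stronglyMeasurable_mk.measurable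
  have hu : ∀ n, u n =ᵐ[m] U (ind (A n)) := fun n => (hUA n).ae_eq_mk.symm
  let S' : X → ℕ → Bool := fun x n => open Classical in decide (u n x ≠ 0)
  have mn : ∀ n, MeasurableSet {x | u n x ≠ 0} := fun n =>
    ((um n) (measurableSet_singleton 0)).compl
  have S'm : Measurable S' := by
    refine measurable_pi_iff.mpr fun n => ?_
    refine measurable_to_bool ?_
    convert mn n using 1
    ext x; simp [S']
  have hgood : ∀ B : Set (ℕ → Bool), MeasurableSet B → good m U (e ⁻¹' B) (S' ⁻¹' B) := by
    intro B hB
    have hgen : (MeasurableSpace.pi : MeasurableSpace (ℕ → Bool))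
        = MeasurableSpace.generateFrom {B | ∃ n, B = {c : ℕ → Bool | c n = true}} := by
      refine le_antisymm ?_ (MeasurableSpace.generateFrom_le ?_)
      · rw [MeasurableSpace.pi]
        refine iSup_le fun n => ?_
        rintro s ⟨t, -, rfl⟩
        have hb : @MeasurableSet _ (MeasurableSpace.generateFrom {B | ∃ n, B = {c : ℕ → Bool | c n = true}})
            {c : ℕ → Bool | c n = true} := MeasurableSpace.measurableSet_generateFrom ⟨n, rfl⟩
        classical
        have : (fun c : ℕ → Bool => c n) ⁻¹' t = (if true ∈ t then {c : ℕ → Bool | c n = true} else ∅) ∪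
            (if false ∈ t then {c : ℕ → Bool | c n = true}ᶜ else ∅) := by
          ext c
          by_cases h1 : true ∈ t <;> by_cases h2 : false ∈ t <;> cases hc : c n <;> simp [h1, h2, hc]
        rw [this]
        refine MeasurableSet.union ?_ ?_
        · split_ifs
          · exact hb
          · exact @MeasurableSet.empty _ (_)
        · split_ifs
          · exact hb.compl
          · exact @MeasurableSet.empty _ (_)
      · rintro _ ⟨n, rfl⟩
        have : Measurable (fun c : ℕ → Bool => c n) := measurable_pi_apply n
        exact this (measurableSet_singleton true)
    have key : MeasurableSet B ∧ good m U (e ⁻¹' B) (S' ⁻¹' B) := by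
      rw [hgen] at hB
      induction B, hB using MeasurableSpace.generateFrom_induction with
      | hC t ht =>
        obtain ⟨n, rfl⟩ := ht
        have h0 : Measurable (fun c : ℕ → Bool => c n) := measurable_pi_apply n
        refine ⟨h0 (measurableSet_singleton true), ?_⟩
        have := H.good_basic hp hp2 (hA n) (hu n)
        have e2 : S' ⁻¹' {c | c n = true} = {x | u n x ≠ 0} := by
          ext x; simp [S']
        rw [e2]
        exact this
      | empty =>
        refine ⟨MeasurableSet.empty, ?_⟩
        have := H.good_compl hp hp2 (m := m) (A := Set.univ) (N := Set.univ) MeasurableSet.univ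
          (Eventually.of_forall fun x => by rw [ind_of_mem (Set.mem_univ x), one_mul])
        simpa using this
      | compl t _ ih => exact ⟨ih.1.compl, H.good_compl hp hp2 (em ih.1) ih.2⟩
      | iUnion t _ ih =>
        refine ⟨MeasurableSet.iUnion fun n => (ih n).1, ?_⟩
        rw [Set.preimage_iUnion, Set.preimage_iUnion]
        exact H.good_iUnion hp hp2 (fun n => em (ih n).1) (fun n => S'm (ih n).1) fun n => (ih n).2
    exact key.2
  let F0 : X → ℝ := hU1.mk _
  have F0m : Measurable F0 := hU1.stronglyMeasurable_mk.measurable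
  have hF0 : U (ind Set.univ) =ᵐ[m] F0 := hU1.ae_eq_mk
  let S : X → X := fun x => r (S' x)
  have Sm : Measurable S := rm.comp S'm
  have hrange : ∀ᵐ x ∂m, F0 x ≠ 0 → S' x ∈ Set.range e := by
    have h1 := hgood _ eemb.measurableSet_range
    rw [Set.preimage_range] at h1
    filter_upwards [h1, hF0] with x h1 h2 h3
    by_contra hc
    rw [ind_of_notMem (A := S' ⁻¹' Set.range e) hc, zero_mul, h2] at h1
    exact h3 h1
  have hind : ∀ B : Set X, MeasurableSet B → ∀ᵐ x ∂m, U (ind B) x = F0 x * ind B (S x) := by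
    intro B hB
    have h1 := hgood _ (eemb.measurableSet_image.mpr hB)
    rw [einj.preimage_image] at h1
    filter_upwards [h1, hF0, hrange] with x h1 h2 h3
    rw [h1, h2, mul_comm]
    by_cases h0 : F0 x = 0
    · rw [h0]; simp
    · obtain ⟨y, hy⟩ := h3 h0
      have hS : S x = y := by simp only [S]; rw [← hy, hr']
      congr 1
      rw [hS]
      by_cases hyB : y ∈ B
      · rw [ind_of_mem hyB, ind_of_mem (A := S' ⁻¹' (e '' B)) (show S' x ∈ e '' B from ⟨y, hyB, hy⟩)]
      · rw [ind_of_notMem hyB, ind_of_notMem (A := S' ⁻¹' (e '' B))]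
        rintro ⟨z, hz, hze⟩
        rw [← hy] at hze
        exact hyB (einj hze ▸ hz)
  have mw : Measurable (fun x => ENNReal.ofReal (|F0 x| ^ p)) := by
    have := continuous_abs.measurable.comp F0m
    simp only [Function.comp_def] at this
    fun_prop
  have hmap : Measure.map S (m.withDensity fun x => ENNReal.ofReal (|F0 x| ^ p)) = m := by
    ext B hB
    rw [Measure.map_apply Sm hB, withDensity_apply _ (Sm hB), ← ind_int hp hB, ← H.iso _ (ind_mem hB),
      ← lintegral_indicator (Sm hB)]
    refine lintegral_congr_ae ?_
    filter_upwards [hind B hB] with x hx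
    rw [hx]
    by_cases hB : S x ∈ B
    · rw [Set.indicator_of_mem (show x ∈ S ⁻¹' B from hB), ind_of_mem hB, mul_one, enorm_rpow_ofReal hp]
    · rw [Set.indicator_of_notMem (show x ∉ S ⁻¹' B from hB), ind_of_notMem hB]
      simp [hp]
  have hIntg : ∀ v : X → ℝ≥0∞, Measurable v →
      ∫⁻ x, ENNReal.ofReal (|F0 x| ^ p) * v (S x) ∂m = ∫⁻ x, v x ∂m := by
    intro v hv
    conv_rhs => rw [← hmap]
    rw [lintegral_map hv Sm]
    have := lintegral_withDensity_eq_lintegral_mul m mw (hv.comp Sm)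
    exact this.symm
  have hintF : ∀ f : X → ℝ, Measurable f → ∫⁻ x, ‖F0 x * f (S x)‖ₑ ^ p ∂m = ∫⁻ x, ‖f x‖ₑ ^ p ∂m := by
    intro f hf
    rw [← hIntg (fun x => ‖f x‖ₑ ^ p) (by fun_prop)]
    refine lintegral_congr fun x => ?_
    rw [enorm_mul, ENNReal.mul_rpow_of_nonneg _ _ hp.le, enorm_rpow_ofReal hp (F0 x)]
  have hform : ∀ f, Measurable f → MemLp f (ENNReal.ofReal p) m → U f =ᵐ[m] fun x => F0 x * f (S x) := by
    intro f fm hf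
    have C0 : (2 : ℝ≥0∞) ^ p ≠ ⊤ := ENNReal.rpow_ne_top_of_nonneg hp.le (by simp)
    have mm : AEStronglyMeasurable (fun x => U f x - F0 x * f (S x)) m :=
      (H.mem f hf).1.sub (F0m.mul (fm.comp Sm)).aestronglyMeasurable
    have bound : ∀ ε : ℝ≥0∞, ε ≠ 0 → ∫⁻ x, ‖U f x - F0 x * f (S x)‖ₑ ^ p ∂m ≤ 2 ^ p * (ε + ε) := by
      intro ε hε
      obtain ⟨g, hg, gm, gL, gU⟩ := dense_ind hp (μ := m)
        (fun g => Measurable g ∧ MemLp g (ENNReal.ofReal p) m ∧ U g =ᵐ[m] fun x => F0 x * g (S x))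
        (by
          intro c s hs _
          have e : (s.indicator fun _ => c) = c • ind s := by
            ext x
            by_cases h : x ∈ s
            · simp [ind_of_mem h, h]
            · simp [ind_of_notMem h, h]
          rw [e]
          refine ⟨(ind_meas hs).const_smul c, (ind_mem hs).const_smul c, ?_⟩
          filter_upwards [H.smul c _ (ind_mem hs), hind s hs] with x h1 h2
          rw [h1, Pi.smul_apply, h2, Pi.smul_apply]
          simp only [smul_eq_mul]; ring)
        (by
          rintro f g ⟨h1, h2, h3⟩ ⟨k1, k2, k3⟩
          refine ⟨h1.add k1, h2.add k2, ?_⟩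
          filter_upwards [H.add f g h2 k2, h3, k3] with x a1 a2 a3
          rw [a1, Pi.add_apply, a2, a3, Pi.add_apply]; ring)
        (fun f h => h.1.aestronglyMeasurable) hf hε
      calc ∫⁻ x, ‖U f x - F0 x * f (S x)‖ₑ ^ p ∂m
          = ∫⁻ x, ‖(U f x - U g x) + F0 x * (g (S x) - f (S x))‖ₑ ^ p ∂m := by
            refine lintegral_congr_ae ?_
            filter_upwards [gU] with x hx
            rw [hx]; congr 2; ring
        _ ≤ 2 ^ p * (∫⁻ x, ‖U f x - U g x‖ₑ ^ p ∂m + ∫⁻ x, ‖F0 x * (g (S x) - f (S x))‖ₑ ^ p ∂m) :=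
            lint_add_le hp ((H.mem f hf).1.sub (H.mem g gL).1)
        _ ≤ 2 ^ p * (ε + ε) := by
            gcongr
            · rw [H.iso_sub hf gL]; exact hg
            · rw [hintF (fun x => g x - f x) (gm.sub fm)]
              refine le_trans (le_of_eq ?_) hg
              refine lintegral_congr fun x => ?_
              rw [enorm_sub_rev]
    have hz : ∫⁻ x, ‖U f x - F0 x * f (S x)‖ₑ ^ p ∂m = 0 := by
      have lim : Tendsto (fun ε : ℝ≥0∞ => (2 : ℝ≥0∞) ^ p * (ε + ε)) (𝓝[≠] 0) (𝓝 (2 ^ p * (0 + 0))) := by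
        refine ENNReal.Tendsto.const_mul ?_ (Or.inr C0)
        exact (tendsto_id.add tendsto_id).mono_left nhdsWithin_le_nhds
      rw [add_zero, mul_zero] at lim
      refine le_antisymm (ge_of_tendsto lim ?_) zero_le
      filter_upwards [self_mem_nhdsWithin] with ε hε
      exact bound ε hε
    filter_upwards [(lint_zero_iff hp mm).mp hz] with x hx
    simp only [Pi.zero_apply] at hx
    linarith
  have hne : ∀ᵐ x ∂m, F0 x ≠ 0 := by
    obtain ⟨v, hv, hUv⟩ := hsurj
    have hv' : MemLp (hv.1.mk v) (ENNReal.ofReal p) m := hv.ae_eq hv.1.ae_eq_mk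
    filter_upwards [hUv, H.congr _ _ hv hv' hv.1.ae_eq_mk,
      hform _ hv.1.stronglyMeasurable_mk.measurable hv'] with x h1 h2 h3 h4
    rw [← h2, h1, h4, zero_mul] at h3
    exact one_ne_zero h3
  let F : X → ℝ := fun x => open Classical in if F0 x = 0 then 1 else F0 x
  have hFF : F =ᵐ[m] F0 := by
    filter_upwards [hne] with x hx
    simp [F, hx]
  refine ⟨S, F, Sm, ?_, ?_, ?_, ?_⟩
  · exact Measurable.ite (F0m (measurableSet_singleton 0)) measurable_const F0m
  · intro x
    simp only [F]
    split_ifs with h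
    · exact one_ne_zero
    · exact h
  · intro v hv
    rw [← hIntg v hv]
    refine lintegral_congr_ae ?_
    filter_upwards [hFF] with x hx
    rw [hx]
  · intro f fm hf
    filter_upwards [hform f fm hf, hFF] with x h1 h2
    rw [h1, h2]

end LpIso

end

section
open Filter Topology

namespace LinData
variable {G : Type*} [Group G] [TopologicalSpace G] {X : Type*} [MeasurableSpace X]
    {m : Measure X} {p : ℝ} {ψ : G → NNReal}

theorem lpIso (L : LinData G m p ψ) (g : G) : LpIso m p (L.U g) :=
  ⟨L.U_mem g, L.U_congr g, L.U_add g, L.U_smul g, L.U_iso g⟩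

open LpIso in
theorem exists_skew [IsFiniteMeasure m] [StandardBorelSpace X] (L : LinData G m p ψ)
    (hp : 0 < p) (hp2 : p ≠ 2) : Nonempty (SkewData G m p ψ) := by
  have one_mem : MemLp (fun _ : X => (1 : ℝ)) (ENNReal.ofReal p) m := memLp_const 1
  have hsurj : ∀ g, ∃ v, MemLp v (ENNReal.ofReal p) m ∧ L.U g v =ᵐ[m] fun _ => 1 := by
    intro g
    refine ⟨L.U g⁻¹ fun _ => 1, L.U_mem _ _ one_mem, ?_⟩
    have h1 := L.U_mul g g⁻¹ _ one_mem
    rw [mul_inv_cancel] at h1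
    exact h1.symm.trans (L.U_one _ one_mem)
  choose S F hS hF hne hmap hform using fun g => (L.lpIso g).lamperti hp hp2 (hsurj g)
  obtain ⟨e, em, einj⟩ := MeasurableSpace.measurable_injection_nat_bool_of_countablySeparated X
  let A : ℕ → Set X := fun n => {x | e x n = true}
  have hA : ∀ n, MeasurableSet (A n) := fun n =>
    ((measurable_pi_apply n).comp em) (measurableSet_singleton true)
  have sep : ∀ x y : X, (∀ n, ind (A n) x = ind (A n) y) → x = y := by
    intro x y h
    apply einj
    ext n
    have := h n
    by_cases hx : x ∈ A n <;> by_cases hy : y ∈ A n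
    · have hx' : e x n = true := hx
      have hy' : e y n = true := hy
      rw [hx', hy']
    · rw [ind_of_mem hx, ind_of_notMem hy] at this; norm_num at this
    · rw [ind_of_notMem hx, ind_of_mem hy] at this; norm_num at this
    · have hx' : e x n ≠ true := hx
      have hy' : e y n ≠ true := hy
      rw [Bool.eq_false_of_not_eq_true hx', Bool.eq_false_of_not_eq_true hy']
  -- composition
  have hcomp : ∀ g h f, Measurable f → MemLp f (ENNReal.ofReal p) m →
      ∀ᵐ x ∂m, F (g * h) x * f (S (g * h) x) = F g x * (F h (S g x) * f (S h (S g x))) := by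
    intro g h f fm hf
    have h1 := hform (g * h) f fm hf
    have h2 := hform h f fm hf
    have mh : MemLp (fun x => F h x * f (S h x)) (ENNReal.ofReal p) m := (L.U_mem h f hf).ae_eq h2
    have h3 := L.U_congr g _ _ (L.U_mem h f hf) mh h2
    have h4 := hform g _ ((hF h).mul (fm.comp (hS h))) mh
    filter_upwards [h1, h3, h4, L.U_mul g h f hf] with x a1 a2 a3 a4
    rw [← a1, a4, a2]
    exact a3
  have hFmul : ∀ g h, F (g * h) =ᵐ[m] fun x => F g x * F h (S g x) := by
    intro g h
    filter_upwards [hcomp g h (fun _ => 1) measurable_const one_mem] with x hx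
    simpa using hx
  have hSmul : ∀ g h, S (g * h) =ᵐ[m] fun x => S h (S g x) := by
    intro g h
    have h1 := ae_all_iff.mpr fun n => hcomp g h (ind (A n)) (ind_meas (hA n)) (ind_mem (hA n))
    filter_upwards [h1, hFmul g h] with x h1 h2
    refine sep _ _ fun n => ?_
    have := h1 n
    rw [← mul_assoc, ← h2] at this
    exact mul_left_cancel₀ (hne _ _) this
  have hFone : F 1 =ᵐ[m] fun _ => 1 := by
    filter_upwards [hform 1 _ measurable_const one_mem, L.U_one _ one_mem] with x h1 h2
    rw [h2] at h1
    simpa using h1.symm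
  have hSone : S 1 =ᵐ[m] id := by
    have h1 := ae_all_iff.mpr fun n => hform 1 (ind (A n)) (ind_meas (hA n)) (ind_mem (hA n))
    have h2 := ae_all_iff.mpr fun n => L.U_one (ind (A n)) (ind_mem (hA n))
    filter_upwards [h1, h2, hFone] with x h1 h2 h3
    refine sep _ _ fun n => ?_
    have := h1 n
    rw [h2 n, h3, one_mul] at this
    exact this.symm
  let b : G → X → ℝ := fun g => (L.b_mem g).1.mk (L.b g)
  have hb : ∀ g, L.b g =ᵐ[m] b g := fun g => (L.b_mem g).1.ae_eq_mk
  have bm : ∀ g, Measurable (b g) := fun g => (L.b_mem g).1.stronglyMeasurable_mk.measurable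
  have bL : ∀ g, MemLp (b g) (ENNReal.ofReal p) m := fun g => (L.b_mem g).ae_eq (hb g)
  refine ⟨⟨S, F, b, hS, hF, bm, hne, hmap, hSone, hFone, ?_, hSmul, hFmul, ?_, ?_, ?_, ?_⟩⟩
  · filter_upwards [hb 1, L.b_one] with x h1 h2
    rw [← h1, h2]; rfl
  · intro g h
    filter_upwards [hb (g * h), hb g, L.b_mul g h, L.U_congr g _ _ (L.b_mem h) (bL h) (hb h),
      hform g _ (bm h) (bL h)] with x h1 h2 h3 h4 h5
    rw [← h1, h3, Pi.add_apply, h4, h5, h2]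
  · intro g
    rw [L.val g]
    refine lintegral_congr_ae ?_
    filter_upwards [hb g] with x h1
    rw [h1]
  · intro g₀ B hB
    refine (L.U_cont g₀ (ind B) (ind_mem hB)).congr fun g => ?_
    refine lintegral_congr_ae ?_
    filter_upwards [hform g (ind B) (ind_meas hB) (ind_mem hB),
      hform g₀ (ind B) (ind_meas hB) (ind_mem hB)] with x h1 h2
    rw [h1, h2]; rfl
  · intro g₀
    refine (L.b_cont g₀).congr fun g => ?_
    refine lintegral_congr_ae ?_
    filter_upwards [hb g, hb g₀] with x h1 h2
    rw [h1, h2]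

end LinData

end

section
open Filter Topology

namespace Gauss
open ProbabilityTheory

/-- characteristic functional -/
noncomputable def chi {Ω : Type*} [MeasurableSpace Ω] (P : Measure Ω) (f : Lp ℝ 2 P) : ℂ :=
  ∫ ω, Complex.exp ((f ω : ℂ) * Complex.I) ∂P

theorem chi_continuous {Ω : Type*} [MeasurableSpace Ω] (P : Measure Ω) [IsProbabilityMeasure P] :
    Continuous (chi P) := by
  have hIntg : ∀ f : Lp ℝ 2 P, Integrable (fun ω => Complex.exp ((f ω : ℂ) * Complex.I)) P := by
    intro f
    refine Integrable.of_bound (C := 1) ?_ (Eventually.of_forall fun ω => ?_)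
    · have := (Lp.stronglyMeasurable f).measurable
      exact (by fun_prop : Measurable fun ω => Complex.exp ((f ω : ℂ) * Complex.I)).aestronglyMeasurable
    · rw [Complex.norm_exp_ofReal_mul_I]
  have : LipschitzWith 1 (chi P) := by
    refine LipschitzWith.of_dist_le_mul fun f g => ?_
    rw [dist_eq_norm, dist_eq_norm]
    unfold chi
    rw [← integral_sub (hIntg f) (hIntg g)]
    have h1 : ∀ a b : ℝ, ‖Complex.exp ((a : ℂ) * Complex.I) - Complex.exp ((b : ℂ) * Complex.I)‖ ≤ ‖a - b‖ := by
      intro a b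
      have e : Complex.exp ((a : ℂ) * Complex.I) - Complex.exp ((b : ℂ) * Complex.I)
          = Complex.exp ((b : ℂ) * Complex.I) * (Complex.exp (Complex.I * ((a - b : ℝ) : ℂ)) - 1) := by
        rw [mul_sub, ← Complex.exp_add]
        congr 2
        · push_cast; ring
        · ring
      rw [e, norm_mul, Complex.norm_exp_ofReal_mul_I, one_mul]
      exact Real.norm_exp_I_mul_ofReal_sub_one_le
    have hfg : MemLp (fun ω => f ω - g ω) 2 P := (Lp.memLp f).sub (Lp.memLp g)
    calc ‖∫ ω, (Complex.exp ((f ω : ℂ) * Complex.I) - Complex.exp ((g ω : ℂ) * Complex.I)) ∂P‖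
        ≤ ∫ ω, ‖f ω - g ω‖ ∂P :=
          norm_integral_le_of_norm_le (hfg.integrable (by norm_num)).norm (Eventually.of_forall fun ω => h1 _ _)
      _ = (eLpNorm (fun ω => f ω - g ω) 1 P).toReal := by
          rw [eLpNorm_one_eq_lintegral_enorm]
          rw [integral_norm_eq_lintegral_enorm hfg.1]
      _ ≤ (eLpNorm (fun ω => f ω - g ω) 2 P).toReal := by
          refine ENNReal.toReal_mono hfg.2.ne ?_
          exact eLpNorm_le_eLpNorm_of_exponent_le (by norm_num) hfg.1
      _ = ‖f - g‖ := by
          rw [Lp.norm_def]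
          congr 1
          exact eLpNorm_congr_ae (Lp.coeFn_sub f g).symm
      _ = (1 : NNReal) * ‖f - g‖ := by simp
  exact this.continuous

/-- the standard gaussian product -/
noncomputable def gm (ι : Type*) : Measure (ι → ℝ) := Measure.infinitePi fun _ => gaussianReal 0 1

instance (ι : Type*) : IsProbabilityMeasure (gm ι) := by unfold gm; infer_instance

variable {ι : Type*}

theorem coord_mem (i : ι) : MemLp (fun ω : ι → ℝ => ω i) 2 (gm ι) := by
  have h := measurePreserving_eval_infinitePi (fun _ : ι => gaussianReal 0 1) i
  exact (memLp_id_gaussianReal' 2 (by norm_num)).comp_measurePreserving h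

/-- coordinates -/
noncomputable def coord (i : ι) : Lp ℝ 2 (gm ι) := (coord_mem i).toLp _

theorem coord_int (i : ι) : ∫ ω : ι → ℝ, ω i ∂(gm ι) = 0 := by
  have h := measurePreserving_eval_infinitePi (fun _ : ι => gaussianReal 0 1) i
  have h2 := integral_map (μ := gm ι) (φ := fun ω : ι → ℝ => ω i) (f := fun x : ℝ => x)
    (measurable_pi_apply i).aemeasurable (by fun_prop)
  have h3 : Measure.map (fun ω : ι → ℝ => ω i) (gm ι) = gaussianReal 0 1 := h.map_eq
  rw [← h2, h3, integral_id_gaussianReal]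

theorem coord_int_sq (i : ι) : ∫ ω : ι → ℝ, ω i * ω i ∂(gm ι) = 1 := by
  have h := measurePreserving_eval_infinitePi (fun _ : ι => gaussianReal 0 1) i
  have h2 := integral_map (μ := gm ι) (φ := fun ω : ι → ℝ => ω i) (f := fun x : ℝ => x * x)
    (measurable_pi_apply i).aemeasurable (by fun_prop)
  have h3 : Measure.map (fun ω : ι → ℝ => ω i) (gm ι) = gaussianReal 0 1 := h.map_eq
  rw [← h2, h3]
  have h4 := variance_of_integral_eq_zero (μ := gaussianReal 0 1) (X := fun x : ℝ => x)
    (by fun_prop) integral_id_gaussianReal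
  rw [variance_fun_id_gaussianReal] at h4
  simp only [← sq, ← h4]
  simp

theorem coord_orth : Orthonormal ℝ (coord : ι → Lp ℝ 2 (gm ι)) := by
  classical
  rw [orthonormal_iff_ite]
  intro i j
  rw [L2.inner_def]
  have e : ∫ ω, inner ℝ ((coord i : Lp ℝ 2 (gm ι)) ω) ((coord j : Lp ℝ 2 (gm ι)) ω) ∂(gm ι)
      = ∫ ω : ι → ℝ, ω i * ω j ∂(gm ι) := by
    refine integral_congr_ae ?_
    filter_upwards [(coord_mem i).coeFn_toLp, (coord_mem j).coeFn_toLp] with ω h1 h2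
    unfold coord
    rw [h1, h2]
    simp [mul_comm]
  rw [e]
  split_ifs with h
  · subst h; exact coord_int_sq i
  · have hind : iIndepFun (fun (i : ι) (ω : ι → ℝ) => ω i) (gm ι) :=
      iIndepFun_infinitePi (X := fun _ x => x) (fun _ => measurable_id)
    have := (hind.indepFun h).integral_fun_mul_eq_mul_integral
      (coord_mem i).1 (coord_mem j).1
    rw [this, coord_int, zero_mul]

theorem chi_finset (s : Finset ι) (a : ι → ℝ) :
    chi (gm ι) (∑ i ∈ s, a i • coord i) = Complex.exp (-((∑ i ∈ s, a i ^ 2 : ℝ) : ℂ) / 2) := by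
  have hind : iIndepFun (fun (i : ι) (ω : ι → ℝ) => a i * ω i) (gm ι) :=
    iIndepFun_infinitePi (X := fun i x => a i * x) (fun i => by fun_prop)
  have mm : ∀ i, Measurable (fun ω : ι → ℝ => a i * ω i) := fun i => by fun_prop
  have h1 := (iIndepFun.restrict hind s).charFun_map_fun_finsetSum_eq_prod
    (fun i _ => (mm i).aemeasurable)
  have h2 := congrFun h1 1
  have hm : ∀ i, charFun ((gm ι).map fun ω : ι → ℝ => a i * ω i) 1 = Complex.exp (-((a i ^ 2 : ℝ) : ℂ) / 2) := by
    intro i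
    have h := measurePreserving_eval_infinitePi (fun _ : ι => gaussianReal 0 1) i
    have h3 : Measure.map (fun ω : ι → ℝ => ω i) (gm ι) = gaussianReal 0 1 := h.map_eq
    have : (gm ι).map (fun ω : ι → ℝ => a i * ω i) = (gaussianReal 0 1).map (a i * ·) := by
      rw [← h3, Measure.map_map (by fun_prop) (by fun_prop)]; rfl
    rw [this, gaussianReal_map_const_mul, charFun_gaussianReal]
    congr 1
    push_cast
    simp
    ring
  rw [Finset.prod_apply] at h2
  simp only [hm] at h2
  rw [← Complex.exp_sum] at h2
  have h4 : chi (gm ι) (∑ i ∈ s, a i • coord i)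
      = charFun ((gm ι).map fun ω : ι → ℝ => ∑ i ∈ s, a i * ω i) 1 := by
    rw [charFun_apply_real, integral_map (Finset.measurable_sum s fun i _ => mm i).aemeasurable (by fun_prop)]
    refine integral_congr_ae ?_
    have h5 : ∀ᵐ ω ∂(gm ι), ∀ i ∈ s, (a i • coord i : Lp ℝ 2 (gm ι)) ω = a i * ω i := by
      rw [Filter.eventually_all_finset]
      intro i _
      filter_upwards [Lp.coeFn_smul (a i) (coord i), (coord_mem i).coeFn_toLp] with ω h1 h2
      rw [h1, Pi.smul_apply]
      unfold coord
      rw [h2, smul_eq_mul]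
    filter_upwards [h5, Lp.coeFn_finsetSum s (fun i => (a i • coord i : Lp ℝ 2 (gm ι)))] with ω h6 h7
    rw [h7, Finset.sum_apply, Finset.sum_congr rfl h6]
    simp
  rw [h4, h2]
  congr 1
  push_cast
  rw [neg_div, Finset.sum_div, ← Finset.sum_neg_distrib]
  exact Finset.sum_congr rfl fun i _ => by ring

end Gauss

end

section
open Filter Topology

namespace Gauss
open ProbabilityTheory

variable {ι : Type*} {H : Type*} [NormedAddCommGroup H] [InnerProductSpace ℝ H]

/-- the Wiener isometry -/
noncomputable def W (e : HilbertBasis ι ℝ H) : H →ₗᵢ[ℝ] Lp ℝ 2 (gm ι) :=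
  (coord_orth (ι := ι)).orthogonalFamily.linearIsometry.comp e.repr.toLinearIsometry

theorem W_basis (e : HilbertBasis ι ℝ H) (i : ι) : W e (e i) = coord i := by
  classical
  have h := (coord_orth (ι := ι)).orthogonalFamily.linearIsometry_apply_single (i := i) (1 : ℝ)
  unfold W
  rw [LinearIsometry.coe_comp, Function.comp_apply, LinearIsometryEquiv.coe_toLinearIsometry, e.repr_self]
  rw [h]
  simp

theorem chi_W (e : HilbertBasis ι ℝ H) (ξ : H) :
    chi (gm ι) (W e ξ) = Complex.exp (-((‖ξ‖ ^ 2 : ℝ) : ℂ) / 2) := by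
  have h := e.hasSum_repr ξ
  have h1 : Tendsto (fun s : Finset ι => chi (gm ι) (W e (∑ i ∈ s, e.repr ξ i • e i))) atTop
      (𝓝 (chi (gm ι) (W e ξ))) :=
    (((chi_continuous (gm ι)).comp (W e).continuous).tendsto ξ).comp h
  have hc : Continuous fun η : H => Complex.exp (-((‖η‖ ^ 2 : ℝ) : ℂ) / 2) := by fun_prop
  have h2 : Tendsto (fun s : Finset ι => Complex.exp (-((‖∑ i ∈ s, e.repr ξ i • e i‖ ^ 2 : ℝ) : ℂ) / 2)) atTop
      (𝓝 (Complex.exp (-((‖ξ‖ ^ 2 : ℝ) : ℂ) / 2))) :=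
    (hc.tendsto ξ).comp h
  refine tendsto_nhds_unique h1 (h2.congr fun s => ?_)
  have e1 : W e (∑ i ∈ s, e.repr ξ i • e i) = ∑ i ∈ s, e.repr ξ i • coord i := by
    rw [map_sum]
    refine Finset.sum_congr rfl fun i _ => ?_
    rw [map_smul, W_basis]
  have e2 : ‖∑ i ∈ s, e.repr ξ i • e i‖ ^ 2 = ∑ i ∈ s, (e.repr ξ i) ^ 2 := by
    rw [← real_inner_self_eq_norm_sq, e.orthonormal.inner_sum]
    exact Finset.sum_congr rfl fun i _ => by simp [sq]
  rw [e1, chi_finset, e2]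

theorem law (e : HilbertBasis ι ℝ H) {v : ι → H} (hv : Orthonormal ℝ v) (Y : ι → (ι → ℝ) → ℝ)
    (hY : ∀ i, Measurable (Y i)) (hYW : ∀ i, Y i =ᵐ[gm ι] W e (v i)) :
    (gm ι).map (fun ω i => Y i ω) = gm ι := by
  have hchi : ∀ (s : Finset ι) (a : s → ℝ), ∫ ω, Complex.exp (((∑ i, a i * Y i ω : ℝ) : ℂ) * Complex.I) ∂(gm ι)
      = Complex.exp (-((∑ i, a i ^ 2 : ℝ) : ℂ) / 2) := by
    intro s a
    have hv' : Orthonormal ℝ (fun i : s => v i) := hv.comp _ Subtype.val_injective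
    have e2 : ‖∑ i : s, a i • v i‖ ^ 2 = ∑ i, a i ^ 2 := by
      rw [← real_inner_self_eq_norm_sq, hv'.inner_sum]
      exact Finset.sum_congr rfl fun i _ => by simp [sq]
    rw [← e2, ← chi_W e]
    refine integral_congr_ae ?_
    have e3 : W e (∑ i : s, a i • v i) = ∑ i : s, a i • W e (v i) := by
      rw [map_sum]
      exact Finset.sum_congr rfl fun i _ => by rw [map_smul]
    rw [e3]
    have h5 : ∀ᵐ ω ∂(gm ι), ∀ i : s, (a i • W e (v i) : Lp ℝ 2 (gm ι)) ω = a i * Y i ω := by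
      rw [ae_all_iff]
      intro i
      filter_upwards [Lp.coeFn_smul (a i) (W e (v i)), hYW i] with ω h1 h2
      rw [h1, Pi.smul_apply, h2, smul_eq_mul]
    filter_upwards [h5, Lp.coeFn_finsetSum Finset.univ (fun i : s => (a i • W e (v i) : Lp ℝ 2 (gm ι)))] with ω h6 h7
    rw [h7, Finset.sum_apply, Finset.sum_congr rfl fun i _ => h6 i]
  have hone : ∀ i (t : ℝ), charFun ((gm ι).map (Y i)) t = Complex.exp (-((t ^ 2 : ℝ) : ℂ) / 2) := by
    intro i t
    rw [charFun_apply_real, integral_map (hY i).aemeasurable (by fun_prop)]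
    have := hchi {i} (fun _ => t)
    simp only [Finset.univ_unique, Finset.sum_singleton] at this
    rw [← this]
    refine integral_congr_ae (Eventually.of_forall fun ω => ?_)
    simp
  have hlaw : ∀ i, (gm ι).map (Y i) = gaussianReal 0 1 := by
    intro i
    have : IsProbabilityMeasure ((gm ι).map (Y i)) := Measure.isProbabilityMeasure_map (hY i).aemeasurable
    refine Measure.ext_of_charFun (funext fun t => ?_)
    rw [hone, charFun_gaussianReal]
    congr 1
    push_cast
    ring
  have hind : iIndepFun Y (gm ι) := by
    rw [iIndepFun_iff_finset]
    intro s
    rw [iIndepFun_iff_charFun_pi (X := s.restrict Y) (fun i => (hY i).aemeasurable)]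
    intro t
    have m1 : Measurable (fun ω => WithLp.toLp 2 (fun i : s => s.restrict Y i ω)) := by
      have : Measurable (fun ω => (fun i : s => s.restrict Y i ω)) := measurable_pi_iff.mpr fun i => hY i
      exact (by fun_prop : Measurable (WithLp.toLp (V := s → ℝ) 2)).comp this
    rw [charFun_apply, integral_map m1.aemeasurable (by fun_prop)]
    have e4 : ∏ i : s, charFun ((gm ι).map (s.restrict Y i)) (t i)
        = ∏ i : s, Complex.exp (-((t i ^ 2 : ℝ) : ℂ) / 2) :=
      Finset.prod_congr rfl fun i _ => hone i (t i)
    rw [e4, ← Complex.exp_sum]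
    have := hchi s (fun i => t i)
    rw [show ∑ i : s, -((t i ^ 2 : ℝ) : ℂ) / 2 = -((∑ i : s, t i ^ 2 : ℝ) : ℂ) / 2 by
      push_cast
      rw [neg_div, Finset.sum_div, ← Finset.sum_neg_distrib]
      exact Finset.sum_congr rfl fun i _ => by ring, ← this]
    refine integral_congr_ae (Eventually.of_forall fun ω => ?_)
    simp only [PiLp.inner_apply, Finset.restrict]
    congr 3
  rw [hind.map_fun_eq_infinitePi_map hY]
  simp only [hlaw]
  rfl

end Gauss

end

section
open Filter Topology

/-- affine isometric Hilbert space action data -/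
structure HilbData (G : Type*) [Group G] [TopologicalSpace G] (H : Type*) [NormedAddCommGroup H]
    [InnerProductSpace ℝ H] (ψ : G → NNReal) where
  T : G → H →ₗᵢ[ℝ] H
  b : G → H
  T_one : ∀ ξ, T 1 ξ = ξ
  T_mul : ∀ g h ξ, T (g * h) ξ = T g (T h ξ)
  b_one : b 1 = 0
  b_mul : ∀ g h, b (g * h) = b g + T g (b h)
  val : ∀ g, (ψ g : ℝ≥0∞) = ENNReal.ofReal (‖b g‖ ^ 2)
  T_cont : ∀ ξ, Continuous fun g => T g ξ
  b_cont : Continuous b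

namespace Gauss

theorem lint_Lp {Ω : Type*} [MeasurableSpace Ω] {P : Measure Ω} (f : Lp ℝ 2 P) {u : Ω → ℝ} (hu : u =ᵐ[P] f) :
    ∫⁻ x, ‖u x‖ₑ ^ (2 : ℝ) ∂P = ENNReal.ofReal (‖f‖ ^ 2) := by
  have h : ∫⁻ x, ‖u x‖ₑ ^ (2 : ℝ) ∂P = ∫⁻ x, ‖f x‖ₑ ^ (2 : ℝ) ∂P :=
    lintegral_congr_ae (by filter_upwards [hu] with x hx; rw [hx])
  rw [h, Lp.norm_def, ← ENNReal.toReal_pow, ENNReal.ofReal_toReal (ENNReal.pow_ne_top (Lp.eLpNorm_ne_top f)),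
    eLpNorm_eq_lintegral_rpow_enorm_toReal two_ne_zero (by norm_num)]
  rw [← ENNReal.rpow_natCast, ← ENNReal.rpow_mul]
  simp

theorem countable_basis {ι : Type*} {H : Type*} [NormedAddCommGroup H] [InnerProductSpace ℝ H]
    [TopologicalSpace.SeparableSpace H] (e : HilbertBasis ι ℝ H) : Countable ι := by
  have h : (Set.univ : Set ι).PairwiseDisjoint fun i => Metric.ball (e i) (1 / 2) := by
    intro i _ j _ hij
    refine Metric.ball_disjoint_ball ?_
    have h0 : inner ℝ (e i) (e j) = 0 := e.orthonormal.2 hij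
    have h1 : ‖e i - e j‖ ^ 2 = 2 := by
      rw [norm_sub_sq_real, h0, e.orthonormal.1, e.orthonormal.1]; norm_num
    rw [dist_eq_norm]
    nlinarith [norm_nonneg (e i - e j)]
  have := h.countable_of_isOpen (fun i _ => Metric.isOpen_ball) (fun i _ => ⟨e i, by simp⟩)
  exact Set.countable_univ_iff.mp this

variable {G : Type*} [Group G] [TopologicalSpace G] {ι : Type*} [Countable ι] {H : Type*} [NormedAddCommGroup H]
    [InnerProductSpace ℝ H] {ψ : G → NNReal}

theorem skew (D : HilbData G H ψ) (e : HilbertBasis ι ℝ H) :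
    Nonempty (SkewData G (gm ι) 2 ψ) := by
  let S : G → (ι → ℝ) → (ι → ℝ) := fun g ω i => W e (D.T g (e i)) ω
  have mW : ∀ ξ, Measurable (W e ξ : (ι → ℝ) → ℝ) := fun ξ => (Lp.stronglyMeasurable _).measurable
  have Sm : ∀ g, Measurable (S g) := fun g => measurable_pi_iff.mpr fun i => mW _
  have Smp : ∀ g, MeasurePreserving (S g) (gm ι) (gm ι) := fun g =>
    ⟨Sm g, law e (v := fun i => D.T g (e i)) (e.orthonormal.comp_linearIsometry (D.T g))
      (fun i => W e (D.T g (e i))) (fun i => mW _) (fun i => EventuallyEq.rfl)⟩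
  have Wb : ∀ i, ∀ᵐ ω ∂(gm ι), W e (e i) ω = ω i := by
    intro i
    rw [W_basis]
    exact (coord_mem i).coeFn_toLp
  have hcomp : ∀ g ξ, ∀ᵐ ω ∂(gm ι), W e ξ (S g ω) = W e (D.T g ξ) ω := by
    intro g ξ
    let C := Lp.compMeasurePreservingₗᵢ (E := ℝ) (p := 2) ℝ (S g) (Smp g)
    have hbase : ∀ i, C (W e (e i)) = W e (D.T g (e i)) := by
      intro i
      apply Lp.ext
      have h1 := (Smp g).quasiMeasurePreserving.ae (Wb i)
      filter_upwards [Lp.coeFn_compMeasurePreserving (W e (e i)) (Smp g), h1] with ω h2 h3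
      refine h2.trans ?_
      rw [Function.comp_apply, h3]
    have hall : C (W e ξ) = W e (D.T g ξ) := by
      have h := e.hasSum_repr ξ
      have l1 : Tendsto (fun s : Finset ι => C (W e (∑ i ∈ s, e.repr ξ i • e i))) atTop (𝓝 (C (W e ξ))) :=
        ((C.continuous.comp (W e).continuous).tendsto ξ).comp h
      have l2 : Tendsto (fun s : Finset ι => W e (D.T g (∑ i ∈ s, e.repr ξ i • e i))) atTop
          (𝓝 (W e (D.T g ξ))) :=
        (((W e).continuous.comp (D.T g).continuous).tendsto ξ).comp h
      refine tendsto_nhds_unique l1 (l2.congr fun s => ?_)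
      simp only [map_sum, map_smul, hbase]
    rw [← hall]
    filter_upwards [Lp.coeFn_compMeasurePreserving (W e ξ) (Smp g)] with ω h2
    exact h2.symm
  have Scont : ∀ g₀ (B : Set (ι → ℝ)), MeasurableSet B →
      Tendsto (fun g => gm ι ((S g ⁻¹' B) ∆ (S g₀ ⁻¹' B))) (𝓝 g₀) (𝓝 0) := by
    intro g₀ B hB
    refine aux_cont_of_pi S Smp g₀ {A | IsOpen A} ?_ isPiSystem_isOpen (fun _ => Set.univ)
      (fun _ => by simp) (fun _ => measure_ne_top _ _) monotone_const (Set.iUnion_const _) ?_ B hB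
      (measure_ne_top _ _)
    · exact BorelSpace.measurable_eq
    intro A hA _
    have hA : IsOpen A := by simpa using hA
    have : Encodable ι := Encodable.ofCountable ι
    obtain ⟨w, wpos, c, hw, -⟩ := posSumOfEncodable (one_pos : (0 : ℝ) < 1) ι
    let d : G → ℝ := fun g => ∑' i, w i * ‖D.T g (e i) - D.T g₀ (e i)‖ ^ 2
    have hbd : ∀ i g, w i * ‖D.T g (e i) - D.T g₀ (e i)‖ ^ 2 ≤ w i * 4 := by
      intro i g
      refine mul_le_mul_of_nonneg_left ?_ (wpos i).le
      have := norm_sub_le (D.T g (e i)) (D.T g₀ (e i))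
      rw [LinearIsometry.norm_map, LinearIsometry.norm_map, e.orthonormal.1] at this
      nlinarith [norm_nonneg (D.T g (e i) - D.T g₀ (e i))]
    have hnn : ∀ i g, 0 ≤ w i * ‖D.T g (e i) - D.T g₀ (e i)‖ ^ 2 := fun i g =>
      mul_nonneg (wpos i).le (by positivity)
    have hsum : Summable fun i => w i * 4 := hw.summable.mul_right 4
    have dcont : Continuous d := by
      refine continuous_tsum (fun i => ?_) hsum (fun i g => ?_)
      · have := D.T_cont (e i)
        fun_prop
      · rw [Real.norm_of_nonneg (hnn i g)]; exact hbd i g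
    have d0 : d g₀ = 0 := by simp [d]
    let u : G → (ι → ℝ) → ℝ≥0∞ := fun g ω => ∑' i, ENNReal.ofReal (w i) * ‖S g ω i - S g₀ ω i‖ₑ ^ (2 : ℝ)
    have um : ∀ g, Measurable (u g) := by
      intro g
      refine Measurable.tsum fun i => ?_
      have h1 : Measurable fun ω => S g ω i := mW _
      have h2 : Measurable fun ω => S g₀ ω i := mW _
      fun_prop
    have hu : ∀ g, ∫⁻ ω, u g ω ∂(gm ι) = ENNReal.ofReal (d g) := by
      intro g
      simp only [u, d]
      rw [lintegral_tsum, ENNReal.ofReal_tsum_of_nonneg (fun i => hnn i g)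
        (Summable.of_nonneg_of_le (fun i => hnn i g) (fun i => hbd i g) hsum)]
      · congr 1
        ext i
        rw [lintegral_const_mul' _ _ ENNReal.ofReal_ne_top, ENNReal.ofReal_mul (wpos i).le]
        congr 1
        rw [lint_Lp (W e (D.T g (e i) - D.T g₀ (e i))), LinearIsometry.norm_map]
        rw [map_sub]
        filter_upwards [Lp.coeFn_sub (W e (D.T g (e i))) (W e (D.T g₀ (e i)))] with ω hω
        rw [hω]; rfl
      · intro i
        have h1 : Measurable fun ω => S g ω i := mW _
        have h2 : Measurable fun ω => S g₀ ω i := mW _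
        exact (by fun_prop : Measurable fun ω => ENNReal.ofReal (w i) * ‖S g ω i - S g₀ ω i‖ₑ ^ (2 : ℝ)).aemeasurable
    have hD : Tendsto (fun g => ENNReal.ofReal (d g)) (𝓝 g₀) (𝓝 0) := by
      have := (ENNReal.continuous_ofReal.comp dcont).tendsto g₀
      simpa [d0, Function.comp_def] using this
    refine aux_tendsto_of_subseq hD fun v hv => ?_
    simp only [← hu] at hv
    obtain ⟨φ, hφ⟩ := aux_ae_subseq (fun n => u (v n)) (fun n => (um _).aemeasurable) hv
    refine ⟨φ, ?_⟩
    refine aux_symmDiff_tendsto (fun k => S (v (φ k))) (S g₀) (fun k => Smp _) (Smp _) hA.measurableSet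
      (measure_ne_top _ _) ?_
    filter_upwards [hφ] with ω hω hA0
    have hlim : Tendsto (fun k => S (v (φ k)) ω) atTop (𝓝 (S g₀ ω)) := by
      rw [tendsto_pi_nhds]
      intro i
      have h1 : Tendsto (fun k => ENNReal.ofReal (w i) * ‖S (v (φ k)) ω i - S g₀ ω i‖ₑ ^ (2 : ℝ)) atTop (𝓝 0) :=
        tendsto_of_tendsto_of_tendsto_of_le_of_le tendsto_const_nhds hω (fun _ => zero_le)
          (fun k => ENNReal.le_tsum (f := fun i => ENNReal.ofReal (w i) * ‖S (v (φ k)) ω i - S g₀ ω i‖ₑ ^ (2 : ℝ)) i)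
      have hw0 : ENNReal.ofReal (w i) ≠ 0 := by simpa using wpos i
      have h2 : Tendsto (fun k => ‖S (v (φ k)) ω i - S g₀ ω i‖ₑ ^ (2 : ℝ)) atTop (𝓝 0) := by
        have := ENNReal.Tendsto.const_mul (a := (ENNReal.ofReal (w i))⁻¹) h1 (Or.inr (by simp [hw0]))
        rw [mul_zero] at this
        refine this.congr fun k => ?_
        rw [← mul_assoc, ENNReal.inv_mul_cancel hw0 ENNReal.ofReal_ne_top, one_mul]
      have h3 : Tendsto (fun k => ‖S (v (φ k)) ω i - S g₀ ω i‖ₑ) atTop (𝓝 0) := by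
        have := h2.ennrpow_const (1 / 2)
        rw [ENNReal.zero_rpow_of_pos (by norm_num)] at this
        refine this.congr fun k => ?_
        rw [← ENNReal.rpow_mul]; norm_num
      rw [tendsto_iff_edist_tendsto_0]
      refine h3.congr fun k => ?_
      rw [edist_eq_enorm_sub]
    exact hlim.eventually (hA.mem_nhds hA0)
  let b : G → (ι → ℝ) → ℝ := fun g => W e (D.b g)
  refine ⟨⟨S, fun _ _ => 1, b, Sm, fun _ => measurable_const, fun g => mW _, fun _ _ => one_ne_zero,
    ?_, ?_, Eventually.of_forall fun _ => rfl, ?_, ?_, fun g h => Eventually.of_forall fun _ => by simp, ?_, ?_, ?_, ?_⟩⟩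
  · intro g u hu
    simp only [abs_one, Real.one_rpow, ENNReal.ofReal_one, one_mul]
    exact (Smp g).lintegral_comp hu
  · filter_upwards [ae_all_iff.mpr Wb] with ω h
    ext i
    simp only [S, D.T_one, id]
    exact h i
  · simp only [b, D.b_one, map_zero]
    exact Lp.coeFn_zero _ _ _
  · intro g h
    filter_upwards [ae_all_iff.mpr fun i => hcomp g (D.T h (e i))] with ω hω
    ext i
    simp only [S, D.T_mul]
    exact (hω i).symm
  · intro g h
    simp only [b, D.b_mul, map_add]
    filter_upwards [Lp.coeFn_add (W e (D.b g)) (W e (D.T g (D.b h))), hcomp g (D.b h)] with ω h1 h2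
    rw [h1, Pi.add_apply, h2, one_mul]
  · intro g
    rw [D.val, lint_Lp (W e (D.b g)) EventuallyEq.rfl, LinearIsometry.norm_map]
  · intro g₀ B hB
    refine (Scont g₀ B hB).congr fun g => ?_
    have mB : MeasurableSet ((S g ⁻¹' B) ∆ (S g₀ ⁻¹' B)) := (Sm g hB).symmDiff (Sm g₀ hB)
    rw [← lintegral_indicator_one mB]
    refine lintegral_congr fun ω => ?_
    by_cases h1 : S g ω ∈ B <;> by_cases h2 : S g₀ ω ∈ B <;>
      simp [Set.indicator, Set.mem_symmDiff, h1, h2]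
  · intro g₀
    have hc : Tendsto (fun g => ENNReal.ofReal (‖D.b g - D.b g₀‖ ^ 2)) (𝓝 g₀) (𝓝 0) := by
      have hb := D.b_cont
      have : Continuous fun g => ENNReal.ofReal (‖D.b g - D.b g₀‖ ^ 2) :=
        ENNReal.continuous_ofReal.comp (by fun_prop)
      simpa using this.tendsto g₀
    refine hc.congr fun g => ?_
    rw [← (W e).norm_map, lint_Lp (W e (D.b g - D.b g₀))]
    rw [map_sub]
    filter_upwards [Lp.coeFn_sub (W e (D.b g)) (W e (D.b g₀))] with ω hω
    rw [hω]; rfl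

end Gauss

end

section
open Filter Topology

theorem aux_ofReal_sq_tendsto {G E : Type*} [TopologicalSpace G] [NormedAddCommGroup E] {f : G → E} {g₀ : G}
    (h : Tendsto (fun g => ENNReal.ofReal (‖f g - f g₀‖ ^ 2)) (𝓝 g₀) (𝓝 0)) : ContinuousAt f g₀ := by
  rw [ContinuousAt, tendsto_iff_norm_sub_tendsto_zero]
  have h1 := (ENNReal.continuousAt_toReal ENNReal.zero_ne_top).tendsto.comp h
  have h2 := (Real.continuous_sqrt.tendsto _).comp h1
  simp only [ENNReal.toReal_zero, Real.sqrt_zero] at h2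
  refine h2.congr fun g => ?_
  simp only [Function.comp]
  rw [ENNReal.toReal_ofReal (by positivity), Real.sqrt_sq (norm_nonneg _)]

theorem LinData.toHilb {G : Type*} [Group G] [TopologicalSpace G] {X : Type*} [MeasurableSpace X]
    {m : Measure X} {ψ : G → NNReal} (L : LinData G m 2 ψ) : Nonempty (HilbData G (Lp ℝ 2 m) ψ) := by
  have e2 : ENNReal.ofReal 2 = 2 := by simp
  obtain ⟨U, b, U_mem, U_congr, U_add, U_smul, U_iso, U_mul, U_one, b_mem, b_one, b_mul, val, U_cont, b_cont⟩ := L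
  rw [e2] at *
  let V : G → Lp ℝ 2 m → Lp ℝ 2 m := fun g f => (U_mem g f (Lp.memLp f)).toLp _
  have hV : ∀ g (f : Lp ℝ 2 m), V g f =ᵐ[m] U g f := fun g f => MemLp.coeFn_toLp _
  have hN : ∀ g f, ‖V g f‖ = ‖f‖ := by
    intro g f
    have h1 := U_iso g f (Lp.memLp f)
    rw [Gauss.lint_Lp (V g f) (hV g f).symm, Gauss.lint_Lp f EventuallyEq.rfl] at h1
    have h2 := (ENNReal.ofReal_eq_ofReal_iff (by positivity) (by positivity)).mp h1
    exact (sq_eq_sq₀ (norm_nonneg _) (norm_nonneg _)).mp h2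
  let B : G → Lp ℝ 2 m := fun g => (b_mem g).toLp _
  have hB : ∀ g, B g =ᵐ[m] b g := fun g => MemLp.coeFn_toLp _
  refine ⟨⟨fun g => ⟨⟨⟨V g, fun f f' => ?_⟩, fun c f => ?_⟩, hN g⟩, B, ?_, ?_, ?_, ?_, ?_, ?_, ?_⟩⟩
  · apply Lp.ext
    have h1 := U_congr g _ _ (Lp.memLp (f + f')) ((Lp.memLp f).add (Lp.memLp f')) (Lp.coeFn_add f f')
    have h2 := U_add g f f' (Lp.memLp f) (Lp.memLp f')
    filter_upwards [h1, h2, hV g (f + f'), hV g f, hV g f', Lp.coeFn_add (V g f) (V g f')] with x a1 a2 a3 a4 a5 a6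
    rw [a3, a1, a2, a6, Pi.add_apply, Pi.add_apply, a4, a5]
  · apply Lp.ext
    have h1 := U_congr g _ _ (Lp.memLp (c • f)) ((Lp.memLp f).const_smul c) (Lp.coeFn_smul c f)
    have h2 := U_smul g c f (Lp.memLp f)
    filter_upwards [h1, h2, hV g (c • f), hV g f, Lp.coeFn_smul c (V g f)] with x a1 a2 a3 a4 a6
    change V g (c • f) x = (c • V g f : Lp ℝ 2 m) x
    rw [a3, a1, a2, a6, Pi.smul_apply, Pi.smul_apply, a4]
  · intro f
    exact Lp.ext ((hV 1 f).trans (U_one f (Lp.memLp f)))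
  · intro g h f
    refine Lp.ext ((hV _ f).trans ((U_mul g h f (Lp.memLp f)).trans ?_))
    exact (U_congr g _ _ (U_mem h f (Lp.memLp f)) (Lp.memLp (V h f)) (hV h f).symm).trans (hV g (V h f)).symm
  · apply Lp.ext
    exact (hB 1).trans (b_one.trans (Lp.coeFn_zero _ _ _).symm)
  · intro g h
    apply Lp.ext
    have h1 := U_congr g _ _ (b_mem h) (Lp.memLp (B h)) (hB h).symm
    filter_upwards [h1, b_mul g h, hB (g * h), hB g, hV g (B h), Lp.coeFn_add (B g) (V g (B h))] with x a1 a2 a3 a4 a5 a6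
    change B (g * h) x = (B g + V g (B h) : Lp ℝ 2 m) x
    rw [a3, a2, a6, Pi.add_apply, Pi.add_apply, a4, a5, a1]
  · intro g
    rw [val g, Gauss.lint_Lp (B g) (hB g).symm]
  · intro f
    refine continuous_iff_continuousAt.mpr fun g₀ => aux_ofReal_sq_tendsto ?_
    refine (U_cont g₀ f (Lp.memLp f)).congr fun g => ?_
    change _ = ENNReal.ofReal (‖V g f - V g₀ f‖ ^ 2)
    refine Gauss.lint_Lp (V g f - V g₀ f) ?_
    filter_upwards [hV g f, hV g₀ f, Lp.coeFn_sub (V g f) (V g₀ f)] with x a1 a2 a3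
    rw [a3, Pi.sub_apply, a1, a2]
  · refine continuous_iff_continuousAt.mpr fun g₀ => aux_ofReal_sq_tendsto ?_
    refine (b_cont g₀).congr fun g => ?_
    refine Gauss.lint_Lp (B g - B g₀) ?_
    filter_upwards [hB g, hB g₀, Lp.coeFn_sub (B g) (B g₀)] with x a1 a2 a3
    rw [a3, Pi.sub_apply, a1, a2]

theorem LinData.skew_two {G : Type*} [Group G] [TopologicalSpace G] {X : Type} [MeasurableSpace X]
    [StandardBorelSpace X] {m : Measure X} [IsFiniteMeasure m] {ψ : G → NNReal} (L : LinData G m 2 ψ) :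
    ∃ (Y : Type) (_ : MeasurableSpace Y) (m' : Measure Y), StandardBorelSpace Y ∧ IsFiniteMeasure m' ∧
      Nonempty (SkewData G m' 2 ψ) := by
  obtain ⟨D⟩ := L.toHilb
  obtain ⟨w, e, -⟩ := exists_hilbertBasis ℝ (Lp ℝ 2 m)
  have : Fact ((2 : ℝ≥0∞) ≠ ∞) := ⟨by norm_num⟩
  have : TopologicalSpace.SeparableSpace (Lp ℝ 2 m) := inferInstance
  have hc : Countable w := Gauss.countable_basis e
  exact ⟨w → ℝ, inferInstance, Gauss.gm w, inferInstance, inferInstance, Gauss.skew D e⟩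

end

/-- **Theorem (main theorem, precise form).** Let `G` be a topological group and
`0 < p < q < ∞`.  Let `ψ : G → ℝ≥0` be continuous with `ψ(g) = ‖α_g(0)‖_{L_p}^p` for a
continuous affine isometric action `α` of `G` on an `L_p` space.  Then there are a
standard σ-finite measure space `(Y,ν)`, a continuous measure-preserving action `σ` of
`G` on `(Y,ν)` and `h ∈ L_∞(Y,ν)` such that `b(g) := h∘σ_g⁻¹ − h ∈ L_q(Y,ν)` with
`ψ(g) = ‖b(g)‖_{L_q}^q` for every `g`.  In particular `ψ(g) = ‖β_g(0)‖_{L_q}^q` for a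
continuous affine isometric action `β` of `G` on an `L_q` space whose linear part comes
from the measure-preserving action `σ` (i.e. `β_g(f) − β_g(0) = f ∘ σ_g⁻¹`). -/
theorem stmt8 {G : Type*} [Group G] [TopologicalSpace G] [IsTopologicalGroup G]
    {p q : ℝ} (hp : 0 < p) (hpq : p < q) (ψ : G → NNReal) (hψ : Continuous ψ)
    (h : ∃ (X : Type) (_ : MeasurableSpace X) (μ : Measure X),
      StandardBorelSpace X ∧ SigmaFinite μ ∧
      ∃ α : AffineIsometricAction G μ p,
        ∀ g : G, (ψ g : ℝ≥0∞) = pPow μ p ((α.act g 0 : X →ₘ[μ] ℝ))) :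
    ∃ (Y : Type) (_ : MeasurableSpace Y) (ν : Measure Y),
      StandardBorelSpace Y ∧ SigmaFinite ν ∧
      ∃ (σ : PMPAction G ν) (h₀ : Y → ℝ),
        Measurable h₀ ∧ (∃ C : ℝ, ∀ᵐ y ∂ν, |h₀ y| ≤ C) ∧
        (∀ g : G, MemLp (fun y => h₀ (σ.σ g⁻¹ y) - h₀ y) (ENNReal.ofReal q) ν) ∧
        (∀ g : G, (ψ g : ℝ≥0∞) = ∫⁻ y, (‖h₀ (σ.σ g⁻¹ y) - h₀ y‖₊ : ℝ≥0∞) ^ q ∂ν) ∧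
        ∃ β : AffineIsometricAction G ν q,
          (∀ (g : G) (f : Lp ℝ (ENNReal.ofReal q) ν),
            (β.act g f : Y →ₘ[ν] ℝ) - (β.act g 0 : Y →ₘ[ν] ℝ)
              = (f : Y →ₘ[ν] ℝ).compMeasurePreserving (σ.σ g⁻¹) (σ.measurePreserving g⁻¹)) ∧
          (∀ g : G, (ψ g : ℝ≥0∞) = pPow ν q ((β.act g 0 : Y →ₘ[ν] ℝ))) := by
  obtain ⟨X, mX, μ, hX, hμ, α, hα⟩ := h
  obtain ⟨m, hm, ⟨L⟩⟩ := α.exists_linData hp ψ hα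
  by_cases hp2 : p = 2
  · subst hp2
    obtain ⟨Y, mY, m', hY, hm', ⟨D⟩⟩ := L.skew_two
    exact D.final hψ hp hpq
  · obtain ⟨D⟩ := L.exists_skew hp hp2
    exact D.final hψ hp hpq
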